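/- arXiv:1404.5896 — 2 statements merged into one kernel-verified Lean document; each statement's English description precedes it below -/
import Mathlib

section
/- Let k be an infinite field, G = SL₂(k[t,t⁻¹]), G₁ = SL₂(k[t]) ≤ G, A = diag(t,1) ∈ GL₂(k[t,t⁻¹]), G₂ = A⁻¹G₁A (explicitly, the set of matrices (a, t⁻¹b; tc, d) with a,b,c,d ∈ k[t] and ad − bc = 1), and Γ = G₁ ∩ G₂. Then G is the amalgamated free product of G₁ and G₂ along Γ: the canonical homomorphism G₁ *_Γ G₂ → G induced by the two inclusions G₁ → G and G₂ → G is an isomorphism. -/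
namespace GH

/-- `SL₂(A)`: the special linear group of 2×2 matrices over `A`. -/
abbrev SL2 (A : Type) [CommRing A] := Matrix.SpecialLinearGroup (Fin 2) A

end GH

/-! ### `SL₂` of Laurent polynomials and its amalgam decomposition -/

namespace GH

variable (k : Type) [Field k]

open LaurentPolynomial in
lemma TmulTneg : (T (-1) * T 1 : LaurentPolynomial k) = 1 := by
  rw [← LaurentPolynomial.T_add, neg_add_cancel, LaurentPolynomial.T_zero]

open LaurentPolynomial in
lemma TnegmulT : (T 1 * T (-1) : LaurentPolynomial k) = 1 := by
  rw [← LaurentPolynomial.T_add, add_neg_cancel, LaurentPolynomial.T_zero]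

open LaurentPolynomial in
lemma DinvD : (!![T (-1), 0; 0, 1] : Matrix (Fin 2) (Fin 2) (LaurentPolynomial k)) *
    !![T 1, 0; 0, 1] = 1 := by
  rw [Matrix.mul_fin_two, Matrix.one_fin_two, TmulTneg]
  ext i j
  fin_cases i <;> fin_cases j <;> simp

open LaurentPolynomial in
lemma DDinv : (!![T 1, 0; 0, 1] : Matrix (Fin 2) (Fin 2) (LaurentPolynomial k)) *
    !![T (-1), 0; 0, 1] = 1 := by
  rw [Matrix.mul_fin_two, Matrix.one_fin_two, TnegmulT]
  ext i j
  fin_cases i <;> fin_cases j <;> simp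

open LaurentPolynomial in
lemma detDinvD (g : SL2 (LaurentPolynomial k)) :
    ((!![T (-1), 0; 0, 1] : Matrix (Fin 2) (Fin 2) (LaurentPolynomial k)) *
      (g : Matrix (Fin 2) (Fin 2) (LaurentPolynomial k)) * !![T 1, 0; 0, 1]).det = 1 := by
  rw [Matrix.det_mul, Matrix.det_mul, g.2, Matrix.det_fin_two_of, Matrix.det_fin_two_of,
    mul_one, mul_one, mul_zero, sub_zero, sub_zero, mul_one, TmulTneg]

/-- The subgroup `G₁ = SL₂(k[t])` of `SL₂(k[t,t⁻¹])`. -/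
noncomputable def G1 : Subgroup (SL2 (LaurentPolynomial k)) :=
  (Matrix.SpecialLinearGroup.map
    (Polynomial.toLaurent : Polynomial k →+* LaurentPolynomial k)).range

open LaurentPolynomial in
/-- Conjugation by the matrix `A(t) = diag(t, 1) ∈ GL₂(k[t,t⁻¹])` on `SL₂(k[t,t⁻¹])`,
`g ↦ A(t)⁻¹ g A(t)`. -/
noncomputable def conjT : SL2 (LaurentPolynomial k) →* SL2 (LaurentPolynomial k) where
  toFun g := ⟨!![T (-1), 0; 0, 1] * (g : Matrix (Fin 2) (Fin 2) (LaurentPolynomial k)) *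
      !![T 1, 0; 0, 1], detDinvD k g⟩
  map_one' := by
    apply Subtype.ext
    show !![T (-1), 0; 0, 1] * (1 : Matrix (Fin 2) (Fin 2) (LaurentPolynomial k)) *
      !![T 1, 0; 0, 1] = 1
    rw [mul_one, DinvD]
  map_mul' g h := by
    apply Subtype.ext
    show !![T (-1), 0; 0, 1] *
        ((g * h : SL2 (LaurentPolynomial k)) : Matrix (Fin 2) (Fin 2) (LaurentPolynomial k)) *
        !![T 1, 0; 0, 1] = _
    rw [Matrix.SpecialLinearGroup.coe_mul]
    show _ = (!![T (-1), 0; 0, 1] * (g : Matrix (Fin 2) (Fin 2) (LaurentPolynomial k)) *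
        !![T 1, 0; 0, 1]) * (!![T (-1), 0; 0, 1] * (h : Matrix (Fin 2) (Fin 2)
          (LaurentPolynomial k)) * !![T 1, 0; 0, 1])
    have e : (!![T (-1), 0; 0, 1] * (g : Matrix (Fin 2) (Fin 2) (LaurentPolynomial k)) *
        !![T 1, 0; 0, 1]) * (!![T (-1), 0; 0, 1] * (h : Matrix (Fin 2) (Fin 2)
          (LaurentPolynomial k)) * !![T 1, 0; 0, 1]) =
        !![T (-1), 0; 0, 1] * ((g : Matrix (Fin 2) (Fin 2) (LaurentPolynomial k)) *
          (!![T 1, 0; 0, 1] * !![T (-1), 0; 0, 1]) *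
          (h : Matrix (Fin 2) (Fin 2) (LaurentPolynomial k))) * !![T 1, 0; 0, 1] := by
      noncomm_ring
    rw [e, DDinv, mul_one]

/-- The subgroup `G₂ = A(t)⁻¹ G₁ A(t)` of `SL₂(k[t,t⁻¹])`. -/
noncomputable def G2 : Subgroup (SL2 (LaurentPolynomial k)) :=
  (G1 k).map (conjT k)

/-- The subgroup `Γ = G₁ ∩ G₂` of `SL₂(k[t,t⁻¹])`. -/
noncomputable def Gam : Subgroup (SL2 (LaurentPolynomial k)) := G1 k ⊓ G2 k

end GH


namespace GH

variable (k : Type) [Field k]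

/-- The pair of groups `G₁`, `G₂` (indexed by `Bool`). -/
noncomputable def amalgFam : Bool → Type
  | true => ↥(G1 k)
  | false => ↥(G2 k)

noncomputable instance (b : Bool) : Group (amalgFam k b) :=
  match b with
  | true => inferInstanceAs (Group ↥(G1 k))
  | false => inferInstanceAs (Group ↥(G2 k))

/-- The inclusions of `Γ = G₁ ∩ G₂` into `G₁` and `G₂`. -/
noncomputable def amalgIncl (b : Bool) : ↥(Gam k) →* amalgFam k b :=
  match b with
  | true => Subgroup.inclusion inf_le_left
  | false => Subgroup.inclusion inf_le_right

/-- The canonical homomorphism from the amalgamated free product `G₁ *_Γ G₂` to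
`SL₂(k[t,t⁻¹])`, induced by the two inclusions. -/
noncomputable def amalgLift :
    Monoid.PushoutI (amalgIncl k) →* SL2 (LaurentPolynomial k) :=
  Monoid.PushoutI.lift
    (fun b => match b with
      | true => (G1 k).subtype
      | false => (G2 k).subtype)
    (Gam k).subtype
    (by intro b; cases b <;> (ext x; rfl))

end GH

namespace GH

open Polynomial LaurentPolynomial Matrix

section Entries

variable {k : Type} [Field k]

/-- The inclusion `SL₂(k[t]) → SL₂(k[t,t⁻¹])`. -/
noncomputable abbrev polySL : SL2 k[X] →* SL2 k[T;T⁻¹] :=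
  Matrix.SpecialLinearGroup.map (toLaurent : k[X] →+* k[T;T⁻¹])

lemma polySL_apply (A : SL2 k[X]) (i j : Fin 2) : polySL A i j = toLaurent (A i j) := rfl

lemma exists_polySL {M : Matrix (Fin 2) (Fin 2) k[X]} (hM : M.det = 1) :
    ∃ A : SL2 k[X], ∀ i j, polySL A i j = toLaurent (M i j) :=
  ⟨⟨M, hM⟩, fun _ _ => rfl⟩

lemma polySL_mem_G1 (A : SL2 k[X]) : polySL A ∈ G1 k := ⟨A, rfl⟩

lemma conjT_coe (g : SL2 k[T;T⁻¹]) :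
    (conjT k g : Matrix (Fin 2) (Fin 2) k[T;T⁻¹]) =
      !![T (-1), 0; 0, 1] * (g : Matrix (Fin 2) (Fin 2) k[T;T⁻¹]) * !![T 1, 0; 0, 1] := rfl

lemma conjT_entries (g : SL2 k[T;T⁻¹]) :
    (conjT k g : Matrix (Fin 2) (Fin 2) k[T;T⁻¹]) =
      !![g 0 0, T (-1) * g 0 1; T 1 * g 1 0, g 1 1] := by
  rw [conjT_coe, Matrix.eta_fin_two (g : Matrix (Fin 2) (Fin 2) k[T;T⁻¹])]
  have h : T (-1) * g 0 0 * T 1 = g 0 0 := by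
    rw [mul_right_comm, TmulTneg, one_mul]
  simp [h, mul_comm _ (T 1), -T_mul]

lemma mem_G1_of_conjT_mem {A : SL2 k[X]} (h : (A 0 1).coeff 0 = 0) :
    conjT k (polySL A) ∈ G1 k := by
  obtain ⟨b, hb⟩ := X_dvd_iff.2 h
  have hdet := A.det_coe
  rw [Matrix.det_fin_two] at hdet
  obtain ⟨B, hB⟩ := exists_polySL (M := !![A 0 0, b; X * A 1 0, A 1 1]) <| by
    rw [Matrix.det_fin_two_of]; linear_combination hdet + A 1 0 * hb
  refine ⟨B, Subtype.ext ?_⟩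
  rw [conjT_entries]
  refine Matrix.ext fun i j => (hB i j).trans ?_
  fin_cases i <;> fin_cases j <;>
    simp [polySL_apply, hb, ← mul_assoc, TmulTneg, -T_mul]

lemma polySL_mem_G2 {A : SL2 k[X]} (h : (A 1 0).coeff 0 = 0) : polySL A ∈ G2 k := by
  obtain ⟨c, hc⟩ := X_dvd_iff.2 h
  have hdet := A.det_coe
  rw [Matrix.det_fin_two] at hdet
  obtain ⟨B, hB⟩ := exists_polySL (M := !![A 0 0, X * A 0 1; c, A 1 1]) <| by
    rw [Matrix.det_fin_two_of]; linear_combination hdet + A 0 1 * hc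
  refine ⟨_, polySL_mem_G1 B, Subtype.ext ?_⟩
  rw [conjT_entries]
  refine Matrix.ext fun i j => ?_
  fin_cases i <;> fin_cases j <;>
    simp [polySL_apply A, hB, hc, ← mul_assoc, TmulTneg, -T_mul]

lemma exists_of_mem_Gam {g : SL2 k[T;T⁻¹]} (hg : g ∈ Gam k) :
    ∃ A : SL2 k[X], polySL A = g ∧ (A 1 0).coeff 0 = 0 := by
  obtain ⟨⟨A, rfl⟩, ⟨_, ⟨B, rfl⟩, h⟩⟩ := hg
  refine ⟨A, rfl, ?_⟩
  have h' : T 1 * toLaurent (B 1 0) = toLaurent (A 1 0) := by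
    have := congrArg (fun M : SL2 k[T;T⁻¹] => M 1 0) h
    simpa [conjT_entries] using this
  rw [← toLaurent_X, ← map_mul] at h'
  rw [← toLaurent_injective h']
  simp

lemma coeff_zero_mul_eq_one {A : SL2 k[X]} (h : (A 1 0).coeff 0 = 0) :
    (A 0 0).coeff 0 * (A 1 1).coeff 0 = 1 := by
  have hdet := A.det_coe
  rw [Matrix.det_fin_two] at hdet
  simpa [mul_coeff_zero, h] using congrArg (fun p : k[X] => p.coeff 0) hdet

end Entries

section PingPong

variable {k : Type} [Field k]

/-- The vectors whose least `t`-adic valuation is `n` and is attained at the second coordinate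
(for `b = true`), or only at the first one (for `b = false`). -/
def HasLevel : Bool → ℤ → (Fin 2 → k[T;T⁻¹]) → Prop
  | true, n, v => ∃ p q : k[X], q.coeff 0 ≠ 0 ∧
      v 0 = T n * toLaurent p ∧ v 1 = T n * toLaurent q
  | false, n, v => ∃ p q : k[X], p.coeff 0 ≠ 0 ∧
      v 0 = T n * toLaurent p ∧ v 1 = T (n + 1) * toLaurent q

/-- The integer indexing the sets `HasLevel b n` in the order in which alternating words
traverse them. -/
def levelRank : Bool → ℤ → ℤ
  | true, n => -2 * n
  | false, n => -2 * n - 1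

lemma exists_hasLevel (b : Bool) : ∃ v : Fin 2 → k[T;T⁻¹], HasLevel b 0 v := by
  cases b
  · exact ⟨![1, 0], 1, 0, by simp, by simp, by simp⟩
  · exact ⟨![0, 1], 0, 1, by simp, by simp, by simp⟩

lemma le_of_T_mul_eq {m n : ℤ} {p q : k[X]} (hp : p.coeff 0 ≠ 0)
    (h : T n * toLaurent p = T m * toLaurent q) : m ≤ n := by
  by_contra! hlt
  obtain ⟨d, hd⟩ := Int.eq_ofNat_of_zero_le (sub_nonneg.2 hlt.le)
  have hm : m = n + d := by omega
  rw [hm, T_add, mul_assoc, ← toLaurent_X_pow, ← map_mul] at h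
  have h' := toLaurent_injective ((isUnit_T n).mul_left_cancel h)
  have hd0 : d ≠ 0 := by omega
  apply hp
  rw [h', mul_coeff_zero, coeff_X_pow]
  simp [hd0.symm]

lemma HasLevel.rank_le {b c : Bool} {m n : ℤ} {v : Fin 2 → k[T;T⁻¹]}
    (h : HasLevel b m v) (h' : HasLevel c n v) : levelRank b m ≤ levelRank c n := by
  cases b <;> cases c <;> obtain ⟨p, q, h0, hp, hq⟩ := h <;>
    obtain ⟨p', q', h0', hp', hq'⟩ := h'
  · have := le_of_T_mul_eq h0 (hp.symm.trans hp')
    simp only [levelRank]; omega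
  · have := le_of_T_mul_eq h0 (hp.symm.trans hp')
    simp only [levelRank]; omega
  · have := le_of_T_mul_eq h0 (hq.symm.trans hq')
    simp only [levelRank]; omega
  · have := le_of_T_mul_eq h0 (hq.symm.trans hq')
    simp only [levelRank]; omega

lemma HasLevel.mulVec_of_mem_Gam {b : Bool} {n : ℤ} {v : Fin 2 → k[T;T⁻¹]}
    (h : HasLevel b n v) {g : SL2 k[T;T⁻¹]} (hg : g ∈ Gam k) :
    HasLevel b n ((g : Matrix (Fin 2) (Fin 2) k[T;T⁻¹]) *ᵥ v) := by
  obtain ⟨A, rfl, hc⟩ := exists_of_mem_Gam hg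
  have hunit := coeff_zero_mul_eq_one hc
  have ha := left_ne_zero_of_mul_eq_one hunit
  have hd := right_ne_zero_of_mul_eq_one hunit
  cases b <;> obtain ⟨p, q, h0, hp, hq⟩ := h
  · obtain ⟨c, hc'⟩ := X_dvd_iff.2 hc
    refine ⟨A 0 0 * p + X * A 0 1 * q, c * p + A 1 1 * q, ?_, ?_, ?_⟩
    · simp [mul_coeff_zero, ha, h0]
    · simp [mulVec, dotProduct, hp, hq, T_add, -T_mul]; ring
    · simp [mulVec, dotProduct, hp, hq, hc', T_add, -T_mul]; ring
  · refine ⟨A 0 0 * p + A 0 1 * q, A 1 0 * p + A 1 1 * q, ?_, ?_, ?_⟩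
    · simp [mul_coeff_zero, hc, hd, h0]
    · simp [mulVec, dotProduct, hp, hq]; ring
    · simp [mulVec, dotProduct, hp, hq]; ring

lemma HasLevel.mulVec_of_mem_G1 {n : ℤ} {v : Fin 2 → k[T;T⁻¹]}
    (h : HasLevel false n v) {g : SL2 k[T;T⁻¹]} (hg : g ∈ G1 k) (hg' : g ∉ Gam k) :
    HasLevel true n ((g : Matrix (Fin 2) (Fin 2) k[T;T⁻¹]) *ᵥ v) := by
  obtain ⟨A, rfl⟩ := hg
  have hc : (A 1 0).coeff 0 ≠ 0 := fun hc => hg' ⟨polySL_mem_G1 A, polySL_mem_G2 hc⟩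
  obtain ⟨p, q, h0, hp, hq⟩ := h
  refine ⟨A 0 0 * p + X * A 0 1 * q, A 1 0 * p + X * A 1 1 * q, ?_, ?_, ?_⟩
  · simp [mul_coeff_zero, hc, h0]
  · simp [mulVec, dotProduct, hp, hq, T_add, -T_mul]; ring
  · simp [mulVec, dotProduct, hp, hq, T_add, -T_mul]; ring

lemma HasLevel.mulVec_of_mem_G2 {n : ℤ} {v : Fin 2 → k[T;T⁻¹]}
    (h : HasLevel true n v) {g : SL2 k[T;T⁻¹]} (hg : g ∈ G2 k) (hg' : g ∉ Gam k) :
    HasLevel false (n - 1) ((g : Matrix (Fin 2) (Fin 2) k[T;T⁻¹]) *ᵥ v) := by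
  obtain ⟨_, ⟨A, rfl⟩, rfl⟩ := hg
  have hb : (A 0 1).coeff 0 ≠ 0 := fun hb =>
    hg' ⟨mem_G1_of_conjT_mem hb, _, polySL_mem_G1 A, rfl⟩
  obtain ⟨p, q, h0, hp, hq⟩ := h
  have hn : (T n : k[T;T⁻¹]) = T (n - 1) * T 1 := by rw [← T_add, sub_add_cancel]
  refine ⟨X * A 0 0 * p + A 0 1 * q, X * A 1 0 * p + A 1 1 * q, ?_, ?_, ?_⟩
  · simp [mul_coeff_zero, hb, h0]
  · rw [conjT_entries]
    simp only [mulVec, dotProduct, Fin.sum_univ_two, hp, hq, hn, polySL_apply, map_add, map_mul,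
      toLaurent_X, of_apply, cons_val_zero, cons_val_one]
    linear_combination (T (n - 1) * toLaurent (A 0 1) * toLaurent q) * TmulTneg k
  · rw [conjT_entries, sub_add_cancel]
    simp only [mulVec, dotProduct, Fin.sum_univ_two, hp, hq, polySL_apply, map_add, map_mul,
      toLaurent_X, of_apply, cons_val_zero, cons_val_one]
    ring

end PingPong

section Injective

variable {k : Type} [Field k]

open Monoid PushoutI

lemma amalgIncl_injective (b : Bool) : Function.Injective (amalgIncl k b) := by
  cases b <;> exact Subgroup.inclusion_injective (by first | exact inf_le_left | exact inf_le_right)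

lemma amalgLift_base (h : Gam k) : amalgLift k (base (amalgIncl k) h) = h :=
  lift_base _ _ _ h

lemma amalgLift_of_true (g : G1 k) :
    amalgLift k (of (φ := amalgIncl k) (i := true) g) = (g : SL2 k[T;T⁻¹]) :=
  lift_of _ _ _ _

lemma amalgLift_of_false (g : G2 k) :
    amalgLift k (of (φ := amalgIncl k) (i := false) g) = (g : SL2 k[T;T⁻¹]) :=
  lift_of _ _ _ _

lemma HasLevel.mulVec_of {i : Bool} (g : amalgFam k i) (hg : g ∉ (amalgIncl k i).range)
    {n : ℤ} {v : Fin 2 → k[T;T⁻¹]} (h : HasLevel (!i) n v) :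
    ∃ m, levelRank (!i) n < levelRank i m ∧ HasLevel i m
      ((amalgLift k (of (φ := amalgIncl k) i g) : Matrix (Fin 2) (Fin 2) k[T;T⁻¹]) *ᵥ v) := by
  cases i with
  | true =>
    refine ⟨n, by simp [levelRank], ?_⟩
    have hg' : Subtype.val (p := (· ∈ G1 k)) g ∉ Gam k := fun hmem => hg ⟨⟨_, hmem⟩, rfl⟩
    erw [amalgLift_of_true g]
    exact HasLevel.mulVec_of_mem_G1 h (Subtype.prop (p := (· ∈ G1 k)) g) hg'
  | false =>
    refine ⟨n - 1, by simp only [levelRank, Bool.not_false]; omega, ?_⟩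
    have hg' : Subtype.val (p := (· ∈ G2 k)) g ∉ Gam k := fun hmem => hg ⟨⟨_, hmem⟩, rfl⟩
    erw [amalgLift_of_false g]
    exact HasLevel.mulVec_of_mem_G2 h (Subtype.prop (p := (· ∈ G2 k)) g) hg'

lemma NormalWord.prod_eq_base_or_hasLevel {d : NormalWord.Transversal (amalgIncl k)}
    (w : NormalWord d) :
    (∃ h, w.prod = base (amalgIncl k) h) ∨
      ∃ (b c : Bool) (m n : ℤ) (v : Fin 2 → k[T;T⁻¹]), w.fstIdx = some c ∧ HasLevel b m v ∧
        HasLevel c n ((amalgLift k w.prod : Matrix (Fin 2) (Fin 2) k[T;T⁻¹]) *ᵥ v) ∧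
        levelRank b m < levelRank c n := by
  classical
  induction w using NormalWord.consRecOn with
  | empty => exact Or.inl ⟨1, by simp⟩
  | cons i g w hmw _ hgr _ ih =>
    right
    rw [NormalWord.prod_cons, map_mul, Matrix.SpecialLinearGroup.coe_mul]
    simp only [← mulVec_mulVec]
    have hfst : (NormalWord.cons g w hmw hgr).fstIdx = some i := by
      simp [NormalWord.cons]
    obtain ⟨h, hw⟩ | ⟨b, c, m, n, v, hc, hv, hv', hlt⟩ := ih
    · obtain ⟨v, hv⟩ := exists_hasLevel (k := k) (!i)
      have hv' := hv.mulVec_of_mem_Gam h.2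
      obtain ⟨m, hm, hlev⟩ := HasLevel.mulVec_of g hgr hv'
      rw [hw, amalgLift_base]
      exact ⟨!i, i, 0, m, v, hfst, hv, hlev, hm⟩
    · obtain rfl : c = !i := by
        rw [hc] at hmw
        exact Bool.eq_not.2 fun h => hmw (congrArg some h)
      obtain ⟨m', hm', hlev⟩ := HasLevel.mulVec_of g hgr hv'
      exact ⟨b, i, m, m', v, hfst, hv, hlev, hlt.trans hm'⟩
  | base h w _ ih =>
    rw [NormalWord.base_smul_eq_smul, NormalWord.prod_base_smul]
    obtain ⟨h', hw⟩ | ⟨b, c, m, n, v, hc, hv, hv', hlt⟩ := ih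
    · exact Or.inl ⟨h * h', by rw [hw, map_mul]⟩
    · refine Or.inr ⟨b, c, m, n, v, hc, hv, ?_, hlt⟩
      rw [map_mul, Matrix.SpecialLinearGroup.coe_mul, ← mulVec_mulVec, amalgLift_base]
      exact hv'.mulVec_of_mem_Gam h.2

lemma amalgLift_injective : Function.Injective (amalgLift k) := by
  classical
  rw [injective_iff_map_eq_one]
  intro x hx
  obtain ⟨d⟩ := NormalWord.transversal_nonempty (amalgIncl k) amalgIncl_injective
  obtain ⟨w, rfl⟩ := (NormalWord.equiv (d := d)).symm.surjective x
  change amalgLift k w.prod = 1 at hx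
  change w.prod = 1
  obtain ⟨h, hw⟩ | ⟨b, c, m, n, v, -, hv, hv', hlt⟩ := NormalWord.prod_eq_base_or_hasLevel w
  · rw [hw, amalgLift_base] at hx
    rw [hw, Subtype.ext (a1 := h) (a2 := 1) hx, map_one]
  · rw [hx, Matrix.SpecialLinearGroup.coe_one, one_mulVec] at hv'
    exact absurd (hv'.rank_le hv) hlt.not_ge

end Injective

section Surjective

variable {k : Type} [Field k]

lemma exists_bezout {v : Fin 2 → k} (hv : v ≠ 0) : ∃ r s : k, v 0 * s - v 1 * r = 1 := by
  by_cases h0 : v 0 = 0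
  · have h1 : v 1 ≠ 0 := fun h1 => hv (by ext i; fin_cases i <;> simp [h0, h1])
    exact ⟨-(v 1)⁻¹, 0, by simp [h1]⟩
  · exact ⟨0, (v 0)⁻¹, by simp [h0]⟩

lemma exists_mul_eq_diag_mul {P : Matrix (Fin 2) (Fin 2) k[X]} {f : k[X]}
    (hP : P.det = X * f) :
    ∃ (U : SL2 k[X]) (Q : Matrix (Fin 2) (Fin 2) k[X]),
      (U : Matrix (Fin 2) (Fin 2) k[X]) * P = !![X, 0; 0, 1] * Q ∧ Q.det = f := by
  have hdet : (constantCoeff.mapMatrix P).det = 0 := by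
    rw [← RingHom.map_det, hP]; simp
  obtain ⟨v, hv, hvP⟩ := exists_vecMul_eq_zero_iff.2 hdet
  obtain ⟨r, s, hrs⟩ := exists_bezout hv
  have hdvd : ∀ j, X ∣ Polynomial.C (v 0) * P 0 j + Polynomial.C (v 1) * P 1 j := fun j => by
    rw [X_dvd_iff]
    simpa [vecMul, dotProduct] using congrFun hvP j
  choose q hq using hdvd
  have hU : (!![.C (v 0), .C (v 1); .C r, .C s] : Matrix (Fin 2) (Fin 2) k[X]).det = 1 := by
    rw [Matrix.det_fin_two_of, ← C_mul, ← C_mul, ← C_sub, hrs, C_1]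
  have hmul : (!![.C (v 0), .C (v 1); .C r, .C s] : Matrix (Fin 2) (Fin 2) k[X]) * P =
      !![X, 0; 0, 1] * !![q 0, q 1;
        Polynomial.C r * P 0 0 + Polynomial.C s * P 1 0,
        Polynomial.C r * P 0 1 + Polynomial.C s * P 1 1] := by
    ext1 i j
    fin_cases i <;> fin_cases j <;> simp [Matrix.mul_apply, Fin.sum_univ_two, hq]
  refine ⟨⟨_, hU⟩, _, hmul, ?_⟩
  have hdets := congrArg Matrix.det hmul
  rw [Matrix.det_mul, Matrix.det_mul, hU, hP, one_mul, Matrix.det_fin_two_of X] at hdets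
  exact mul_left_cancel₀ X_ne_zero (by simpa using hdets.symm)

/-- The Weyl element of `SL₂(k[t])`. -/
noncomputable def weyl : SL2 k[X] := ⟨!![0, 1; -1, 0], by simp⟩

lemma weyl_coe : ((weyl : SL2 k[X]) : Matrix (Fin 2) (Fin 2) k[X]) = !![0, 1; -1, 0] := rfl

lemma weyl_inv_coe :
    ((weyl⁻¹ : SL2 k[X]) : Matrix (Fin 2) (Fin 2) k[X]) = !![0, -1; 1, 0] := by
  rw [Matrix.SpecialLinearGroup.coe_inv, weyl_coe, Matrix.adjugate_fin_two_of, neg_neg]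

lemma mem_of_eq_T_smul {H : Subgroup (SL2 k[T;T⁻¹])} (h1 : G1 k ≤ H) (h2 : G2 k ≤ H) (n : ℕ) :
    ∀ (P : Matrix (Fin 2) (Fin 2) k[X]) (g : SL2 k[T;T⁻¹]), P.det = X ^ (2 * n) →
      (g : Matrix (Fin 2) (Fin 2) k[T;T⁻¹]) =
        (T (-n) : k[T;T⁻¹]) • (toLaurent : k[X] →+* k[T;T⁻¹]).mapMatrix P → g ∈ H := by
  induction n with
  | zero =>
    intro P g hP hg
    refine h1 ⟨⟨P, by simpa using hP⟩, Subtype.ext ?_⟩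
    rw [hg, Nat.cast_zero, neg_zero, T_zero, one_smul]
    rfl
  | succ n ih =>
    intro P g hP hg
    obtain ⟨U, Q, hUQ, hQ⟩ := exists_mul_eq_diag_mul
      (hP.trans (show X ^ (2 * (n + 1)) = X * (X * X ^ (2 * n)) by ring))
    obtain ⟨V, R, hVR, hR⟩ := exists_mul_eq_diag_mul hQ
    have hg1 : conjT k (polySL (V * weyl⁻¹)) ∈ H := h2 ⟨_, polySL_mem_G1 _, rfl⟩
    have hg2 : polySL (weyl * U) ∈ H := h1 (polySL_mem_G1 _)
    rw [← H.mul_mem_cancel_left hg2, ← H.mul_mem_cancel_left hg1]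
    refine ih R _ hR ?_
    set M := (toLaurent : k[X] →+* k[T;T⁻¹]).mapMatrix (m := Fin 2)
    have hpoly : ∀ A : SL2 k[X], (polySL A : Matrix (Fin 2) (Fin 2) k[T;T⁻¹]) = M A :=
      fun _ => rfl
    have hD : M !![X, 0; 0, 1] = !![T 1, 0; 0, 1] := by
      ext1 i j; fin_cases i <;> fin_cases j <;> simp [M]
    have hweyl : M (weyl⁻¹ : SL2 k[X]) * !![T 1, 0; 0, 1] * M (weyl : SL2 k[X]) =
        (T 1 : k[T;T⁻¹]) • !![T (-1), 0; 0, 1] := by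
      rw [weyl_coe, weyl_inv_coe]
      ext1 i j
      fin_cases i <;> fin_cases j <;>
        simp [M, Matrix.mul_apply, Fin.sum_univ_two, TnegmulT, -T_mul]
    have hUQ' := congrArg M hUQ
    have hVR' := congrArg M hVR
    rw [map_mul, map_mul, hD] at hUQ' hVR'
    have hT : (T 1 * T (-((n + 1 : ℕ) : ℤ)) : k[T;T⁻¹]) = T (-(n : ℤ)) := by
      rw [← T_add]; congr 1; push_cast; ring
    rw [Matrix.SpecialLinearGroup.coe_mul, Matrix.SpecialLinearGroup.coe_mul, conjT_coe, hpoly,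
      hpoly, hg, Matrix.SpecialLinearGroup.coe_mul, Matrix.SpecialLinearGroup.coe_mul, map_mul,
      map_mul]
    calc _ = (T (-((n + 1 : ℕ) : ℤ)) : k[T;T⁻¹]) • (!![T (-1), 0; 0, 1] * M V *
          (M (weyl⁻¹ : SL2 k[X]) * !![T 1, 0; 0, 1] * M (weyl : SL2 k[X])) * (M U * M P)) := by
          simp only [Matrix.mul_smul, Matrix.mul_assoc]
      _ = (T 1 * T (-((n + 1 : ℕ) : ℤ)) : k[T;T⁻¹]) • (!![T (-1), 0; 0, 1] * (M V *
          ((!![T (-1), 0; 0, 1] * !![T 1, 0; 0, 1]) * M Q))) := by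
          rw [hweyl, hUQ', mul_comm (T 1), mul_smul]
          simp only [Matrix.mul_smul, Matrix.smul_mul, Matrix.mul_assoc]
      _ = _ := by
          rw [DinvD, Matrix.one_mul, hVR', ← Matrix.mul_assoc, DinvD, Matrix.one_mul, hT]

lemma exists_mapMatrix_eq_smul (g : Matrix (Fin 2) (Fin 2) k[T;T⁻¹]) :
    ∃ (n : ℕ) (P : Matrix (Fin 2) (Fin 2) k[X]),
      (toLaurent : k[X] →+* k[T;T⁻¹]).mapMatrix P = (T n : k[T;T⁻¹]) • g := by
  choose N p hp using fun i j => exists_T_pow (g i j)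
  have hN : ∀ i j, ∃ d, ∑ i, ∑ j, N i j = N i j + d := fun i j =>
    Nat.exists_eq_add_of_le <| (Finset.single_le_sum (f := N i) (by simp) (Finset.mem_univ j)).trans
      (Finset.single_le_sum (f := fun i => ∑ j, N i j) (by simp) (Finset.mem_univ i))
  choose d hd using hN
  refine ⟨∑ i, ∑ j, N i j, Matrix.of fun i j => p i j * X ^ d i j, ?_⟩
  ext1 i j
  rw [hd i j, Nat.cast_add, T_add]
  simp only [RingHom.mapMatrix_apply, Matrix.map_apply, of_apply, map_mul, hp,
    toLaurent_X_pow, Matrix.smul_apply, smul_eq_mul]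
  ring

lemma amalgLift_surjective : Function.Surjective (amalgLift k) := by
  intro g
  obtain ⟨n, P, hP⟩ := exists_mapMatrix_eq_smul (g : Matrix (Fin 2) (Fin 2) k[T;T⁻¹])
  rw [← MonoidHom.mem_range]
  have h1 : G1 k ≤ (amalgLift k).range := fun x hx => ⟨_, amalgLift_of_true ⟨x, hx⟩⟩
  have h2 : G2 k ≤ (amalgLift k).range := fun x hx => ⟨_, amalgLift_of_false ⟨x, hx⟩⟩
  refine mem_of_eq_T_smul h1 h2 n P g ?_ ?_
  · apply toLaurent_injective
    have := congrArg Matrix.det hP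
    rw [← RingHom.map_det, Matrix.det_smul, g.det_coe, mul_one, Fintype.card_fin, T_pow] at this
    rw [this, toLaurent_X_pow]
    simp
  · rw [hP, smul_smul, ← T_add, neg_add_cancel, T_zero, one_smul]

end Surjective

end GH

/-- For an infinite field `k`, `SL₂(k[t,t⁻¹])` is the amalgamated free product
of `G₁ = SL₂(k[t])` and `G₂ = A(t)⁻¹ G₁ A(t)` (where `A(t) = diag(t,1) ∈ GL₂(k[t,t⁻¹])`) along
`Γ = G₁ ∩ G₂`: the canonical homomorphism `G₁ *_Γ G₂ → SL₂(k[t,t⁻¹])` induced by the two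
inclusions is an isomorphism. -/
theorem statement0 (k : Type) [Field k] [Infinite k] :
    Function.Bijective (GH.amalgLift k) := by
  exact ⟨GH.amalgLift_injective, GH.amalgLift_surjective⟩
end

section
/- Let q ≥ 4 be a prime power and F_q the finite field with q elements. Then P(F_q) ⊗_Z Z[1/2] is isomorphic to Z/m, where m is the odd part of q + 1 (i.e., the largest odd divisor of q + 1). -/
namespace GH

variable (k : Type) [Field k]

/-- For a unit `x ≠ 1` of a field, `1 - x` as a unit. -/
def oneSub (x : kˣ) (h : (x : k) ≠ 1) : kˣ :=
  Units.mk0 (1 - (x : k)) (sub_ne_zero.mpr (Ne.symm h))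

end GH

/-! ### Scissors congruence groups, refined scissors congruence groups and Bloch groups -/

namespace GH

variable (k : Type) [Field k]

/-- For a unit `x ≠ 1` of a field, `1 - x⁻¹` as a unit. -/
def oneSubInv (x : kˣ) (h : (x : k) ≠ 1) : kˣ :=
  Units.mk0 (1 - (x : k)⁻¹)
    (sub_ne_zero.mpr (fun hh => h (by rw [← inv_inv (x : k), ← hh, inv_one])))

/-- The relations defining the scissors congruence group `P(k)`: `[1] = 0` together with the
five term relations `[x] − [y] + [y/x] − [(1−x⁻¹)/(1−y⁻¹)] + [(1−x)/(1−y)] = 0` for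
`x, y ∈ k^× \ {1}`. -/
def pRelSet : Set (FreeAbelianGroup kˣ) :=
  {FreeAbelianGroup.of (1 : kˣ)} ∪
    {z | ∃ (x y : kˣ) (hx : (x : k) ≠ 1) (hy : (y : k) ≠ 1),
      z = FreeAbelianGroup.of x - FreeAbelianGroup.of y + FreeAbelianGroup.of (y / x) -
        FreeAbelianGroup.of (oneSubInv k x hx / oneSubInv k y hy) +
        FreeAbelianGroup.of (oneSub k x hx / oneSub k y hy)}

/-- The scissors congruence group `P(k)` of the field `k`. -/
def P := FreeAbelianGroup kˣ ⧸ AddSubgroup.closure (pRelSet k)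

noncomputable instance : AddCommGroup (P k) := by unfold P; infer_instance

/-- The generator `[x]` of `P(k)`. -/
def pGen (x : kˣ) : P k := QuotientAddGroup.mk (FreeAbelianGroup.of x)

/-- The group of square classes `k^×/(k^×)²`. -/
def Qsq := kˣ ⧸ (powMonoidHom 2 : kˣ →* kˣ).range

noncomputable instance : CommGroup (Qsq k) := by unfold Qsq; infer_instance

/-- The group ring `R_k = ℤ[k^×/(k^×)²]`. -/
abbrev Rk := MonoidAlgebra ℤ (Qsq k)

/-- The square class `⟨a⟩ ∈ R_k` of a unit `a`. -/
noncomputable def rkOf (a : kˣ) : Rk k :=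
  MonoidAlgebra.of ℤ (Qsq k) (QuotientGroup.mk a)

/-- The element `⟨⟨a⟩⟩ = ⟨a⟩ - 1` of the augmentation ideal of `R_k`. -/
noncomputable def rkAug (a : kˣ) : Rk k := rkOf k a - 1

/-- The relations defining the refined scissors congruence group `RP(k)`: `[1] = 0` together
with the refined five term relations
`[x] − [y] + ⟨x⟩[y/x] − ⟨x⁻¹−1⟩[(1−x⁻¹)/(1−y⁻¹)] + ⟨1−x⟩[(1−x)/(1−y)] = 0`
for `x, y ∈ k^× \ {1}`. -/
noncomputable def rpRelSet : Set (kˣ →₀ Rk k) :=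
  {Finsupp.single (1 : kˣ) (1 : Rk k)} ∪
    {z | ∃ (x y : kˣ) (hx : (x : k) ≠ 1) (hy : (y : k) ≠ 1),
      z = Finsupp.single x (1 : Rk k) - Finsupp.single y 1 +
        rkOf k x • Finsupp.single (y / x) 1 -
        rkOf k (oneSubInv k x hx * x⁻¹) • Finsupp.single (oneSubInv k x hx / oneSubInv k y hy) 1 +
        rkOf k (oneSub k x hx) • Finsupp.single (oneSub k x hx / oneSub k y hy) 1}

/-- The refined scissors congruence group `RP(k)` of the field `k`, an `R_k`-module. -/
noncomputable def RP := (kˣ →₀ Rk k) ⧸ Submodule.span (Rk k) (rpRelSet k)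

noncomputable instance : AddCommGroup (RP k) := by unfold RP; infer_instance
noncomputable instance : Module (Rk k) (RP k) := by unfold RP; infer_instance

/-- The generator `[x]` of `RP(k)`. -/
noncomputable def rpGen (x : kˣ) : RP k :=
  Submodule.Quotient.mk (Finsupp.single x (1 : Rk k))

/-- The graded symmetric square `Sym²_ℤ(k^×) = (k^× ⊗_ℤ k^×)/⟨x⊗y + y⊗x⟩`. -/
noncomputable def SymSq :=
  (TensorProduct ℤ (Additive kˣ) (Additive kˣ)) ⧸
    (Submodule.span ℤ {z : TensorProduct ℤ (Additive kˣ) (Additive kˣ) |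
      ∃ a b : kˣ, z = Additive.ofMul a ⊗ₜ[ℤ] Additive.ofMul b +
        Additive.ofMul b ⊗ₜ[ℤ] Additive.ofMul a})

noncomputable instance : AddCommGroup (SymSq k) := by unfold SymSq; infer_instance

/-- The element `a ∘ b` of `Sym²_ℤ(k^×)`. -/
noncomputable def symMk (a b : kˣ) : SymSq k :=
  Submodule.Quotient.mk (Additive.ofMul a ⊗ₜ[ℤ] Additive.ofMul b)

/-- `lam1` is the `R_k`-homomorphism `λ₁ : RP(k) → R_k`, `[x] ↦ ⟨⟨x⟩⟩⟨⟨1−x⟩⟩`. -/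
noncomputable def IsLambda1 (lam1 : RP k →ₗ[Rk k] Rk k) : Prop :=
  ∀ (x : kˣ) (hx : (x : k) ≠ 1),
    lam1 (rpGen k x) = rkAug k x * rkAug k (oneSub k x hx)

/-- `lam2` is the `R_k`-homomorphism `λ₂ : RP(k) → Sym²_ℤ(k^×)`, `[x] ↦ x ∘ (1−x)`, where the
target carries the trivial `R_k`-action. -/
noncomputable def IsLambda2 (lam2 : RP k →+ SymSq k) : Prop :=
  (∀ (a : kˣ) (z : RP k), lam2 (rkOf k a • z) = lam2 z) ∧
    ∀ (x : kˣ) (hx : (x : k) ≠ 1), lam2 (rpGen k x) = symMk k x (oneSub k x hx)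

/-- `lam` is the homomorphism `λ : P(k) → Sym²_ℤ(k^×)`, `[x] ↦ x ∘ (1−x)`, whose kernel is
the Bloch group `B(k)`. -/
noncomputable def IsPLambda (lam : P k →+ SymSq k) : Prop :=
  ∀ (x : kˣ) (hx : (x : k) ≠ 1), lam (pGen k x) = symMk k x (oneSub k x hx)

/-- `rho` is the natural homomorphism `RP(k) → P(k)`, `⟨a⟩[x] ↦ [x]`, collapsing the
`R_k`-module structure. -/
noncomputable def IsRPtoP (rho : RP k →+ P k) : Prop :=
  ∀ (a x : kˣ), rho (rkOf k a • rpGen k x) = pGen k x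

end GH

namespace GH

/-- `ℤ[1/2]`, the subring of `ℚ` generated by `1/2`. -/
def ZhalfSub : Subring ℚ := Subring.closure {(2 : ℚ)⁻¹}

/-- The ring `ℤ[1/2]`. -/
abbrev Zhalf : Type := ZhalfSub

/-- For an abelian group `M`, `M[1/2] := M ⊗_ℤ ℤ[1/2]`. -/
abbrev Half (M : Type) [AddCommGroup M] : Type := TensorProduct ℤ M Zhalf

end GH

namespace GH

/-- A function on a field that vanishes at `1` and satisfies the five term relation, with values
in a group without `2`-torsion. -/
structure IsFiveTerm {F A : Type*} [Field F] [AddCommGroup A] (b : F → A) : Prop where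
  map_one : b 1 = 0
  five_term : ∀ x y : F, x ≠ 0 → x ≠ 1 → y ≠ 0 → y ≠ 1 →
    b x - b y + b (y / x) - b ((1 - x⁻¹) / (1 - y⁻¹)) + b ((1 - x) / (1 - y)) = 0
  eq_zero_of_add_self : ∀ t : A, t + t = 0 → t = 0

namespace IsFiveTerm

variable {F A : Type*} [Field F] [AddCommGroup A] {b : F → A}

lemma inv_add_mul (h : IsFiveTerm b) {a c : F} (ha : a ≠ 0) (ha1 : a ≠ 1) (hc : c ≠ 0)
    (hc1 : c ≠ 1) (hac : a * c ≠ 1) :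
    b (a * c) + b (a * c)⁻¹ = b a + b a⁻¹ + (b c + b c⁻¹) := by
  have d1 : a - 1 ≠ 0 := sub_ne_zero.2 ha1
  have d2 : c - 1 ≠ 0 := sub_ne_zero.2 hc1
  have d3 : a * c - 1 ≠ 0 := sub_ne_zero.2 hac
  obtain ⟨x, hx⟩ : ∃ x, x = (a - 1) / (a * c - 1) := ⟨_, rfl⟩
  obtain ⟨y, hy⟩ : ∃ y, y = c * x := ⟨_, rfl⟩
  have ex : 1 - x = a * (c - 1) / (a * c - 1) := by rw [hx]; field_simp; ring
  have ey : 1 - y = (c - 1) / (a * c - 1) := by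
    rw [hy, hx, eq_div_iff d3, sub_mul, mul_assoc, div_mul_cancel₀ _ d3]; ring
  have x0 : x ≠ 0 := by rw [hx]; exact div_ne_zero d1 d3
  have y0 : y ≠ 0 := by rw [hy]; exact mul_ne_zero hc x0
  have x1' : 1 - x ≠ 0 := by rw [ex]; exact div_ne_zero (mul_ne_zero ha d2) d3
  have y1' : 1 - y ≠ 0 := by rw [ey]; exact div_ne_zero d2 d3
  have x1 : x ≠ 1 := fun e => x1' (by rw [e, sub_self])
  have y1 : y ≠ 1 := fun e => y1' (by rw [e, sub_self])
  have e1 : y / x = c := by rw [hy]; field_simp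
  have e2 : (1 - x) / (1 - y) = a := by rw [ex, ey]; field_simp
  have x1'' : x - 1 ≠ 0 := sub_ne_zero.2 x1
  have y1'' : y - 1 ≠ 0 := sub_ne_zero.2 y1
  have e3 : (1 - x⁻¹) / (1 - y⁻¹) = a * c := by
    have : (1 - x⁻¹) / (1 - y⁻¹) = ((1 - x) / (1 - y)) * (y / x) := by field_simp; ring
    rw [this, e1, e2]
  have r1 := h.five_term x y x0 x1 y0 y1
  have r2 := h.five_term y x y0 y1 x0 x1
  rw [e1, e2, e3] at r1
  rw [← inv_div y x, ← inv_div (1 - x) (1 - y), ← inv_div (1 - x⁻¹) (1 - y⁻¹), e1, e2, e3] at r2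
  linear_combination (norm := module) -r1 - r2

variable [Fintype F]

lemma map_inv (h : IsFiveTerm b) (hF : 4 ≤ Fintype.card F) {x : F} (hx : x ≠ 0) :
    b x⁻¹ = - b x := by
  by_cases hx1 : x = 1
  · simp [hx1, h.map_one]
  classical
  obtain ⟨a, ha⟩ : ∃ a : F, a ∉ ({0, 1, x⁻¹} : Finset F) := by
    by_contra! hh
    have h1 : (Finset.univ : Finset F) ⊆ {0, 1, x⁻¹} := fun a _ => hh a
    have := (Finset.card_le_card h1).trans Finset.card_le_three
    rw [Finset.card_univ] at this
    omega
  simp only [Finset.mem_insert, Finset.mem_singleton, not_or] at ha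
  obtain ⟨a0, a1, ax⟩ := ha
  have hax : a * x ≠ 1 := fun e => ax (eq_inv_of_mul_eq_one_left e)
  have r1 := h.inv_add_mul a0 a1 hx hx1 hax
  have e : a * x * x⁻¹ = a := by field_simp
  have r2 := h.inv_add_mul (mul_ne_zero a0 hx) hax (inv_ne_zero hx) (inv_ne_one.2 hx1)
    (by rw [e]; exact a1)
  rw [e, inv_inv] at r2
  have := h.eq_zero_of_add_self (b x + b x⁻¹) (by linear_combination (norm := module) -r1 - r2)
  exact eq_neg_of_add_eq_zero_right this

lemma exists_map_one_sub (h : IsFiveTerm b) (hF : 4 ≤ Fintype.card F) :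
    ∃ C : A, ∀ x : F, x ≠ 0 → x ≠ 1 → b (1 - x) = C - b x := by
  have key : ∀ x y : F, x ≠ 0 → x ≠ 1 → y ≠ 0 → y ≠ 1 →
      b x + b (1 - x) = b y + b (1 - y) := by
    intro x y x0 x1 y0 y1
    have x1' : 1 - x ≠ 0 := sub_ne_zero.2 (Ne.symm x1)
    have y1' : 1 - y ≠ 0 := sub_ne_zero.2 (Ne.symm y1)
    have x1'' : x - 1 ≠ 0 := sub_ne_zero.2 x1
    have y1'' : y - 1 ≠ 0 := sub_ne_zero.2 y1
    have r1 := h.five_term x y x0 x1 y0 y1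
    have r2 := h.five_term (1 - x) (1 - y) x1' (by simpa using x0) y1' (by simpa using y0)
    have e : (1 - (1 - x)⁻¹) / (1 - (1 - y)⁻¹) = ((1 - x⁻¹) / (1 - y⁻¹))⁻¹ := by
      have t1 : 1 - (1 - x)⁻¹ = - x / (1 - x) := by field_simp; ring
      have t2 : 1 - (1 - y)⁻¹ = - y / (1 - y) := by field_simp; ring
      have t3 : 1 - x⁻¹ = - (1 - x) / x := by field_simp; ring
      have t4 : 1 - y⁻¹ = - (1 - y) / y := by field_simp; ring
      rw [t1, t2, t3, t4]
      field_simp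
    rw [e, sub_sub_cancel, sub_sub_cancel, ← inv_div y x, ← inv_div (1 - x) (1 - y),
      h.map_inv hF (div_ne_zero y0 x0), h.map_inv hF (div_ne_zero x1' y1'), h.map_inv hF] at r2
    · linear_combination (norm := module) r1 + r2
    · refine div_ne_zero ?_ ?_
      · exact sub_ne_zero.2 (Ne.symm (inv_ne_one.2 x1))
      · exact sub_ne_zero.2 (Ne.symm (inv_ne_one.2 y1))
  by_cases hx : ∃ x : F, x ≠ 0 ∧ x ≠ 1
  · obtain ⟨x, x0, x1⟩ := hx
    refine ⟨b x + b (1 - x), fun y y0 y1 => ?_⟩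
    rw [key x y x0 x1 y0 y1]
    abel
  · exact ⟨0, fun x x0 x1 => absurd ⟨x, x0, x1⟩ hx⟩

lemma three_smul_eq_zero (h : IsFiveTerm b) (hF : 4 ≤ Fintype.card F) {C : A}
    (hC : ∀ x : F, x ≠ 0 → x ≠ 1 → b (1 - x) = C - b x) : C + C + C = 0 := by
  obtain ⟨x, hx⟩ : ∃ x : F, x ∉ ({0, 1} : Set F) := by
    by_contra! hh
    classical
    have h1 : (Finset.univ : Finset F) ⊆ {0, 1} := fun a _ => by simpa using hh a
    have := (Finset.card_le_card h1).trans Finset.card_le_two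
    rw [Finset.card_univ] at this
    omega
  simp only [Set.mem_insert_iff, Set.mem_singleton_iff, not_or] at hx
  obtain ⟨x0, x1⟩ := hx
  have x1' : 1 - x ≠ 0 := sub_ne_zero.2 (Ne.symm x1)
  have x1'' : x - 1 ≠ 0 := sub_ne_zero.2 x1
  have y1' : 1 - x⁻¹ ≠ 0 := sub_ne_zero.2 (Ne.symm (inv_ne_one.2 x1))
  have s1 := hC (1 - x)⁻¹ (inv_ne_zero x1') (by rw [Ne, inv_eq_one]; simpa using x0)
  have e : 1 - (1 - x)⁻¹ = (1 - x⁻¹)⁻¹ := by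
    have t1 : 1 - (1 - x)⁻¹ = - x / (1 - x) := by field_simp; ring
    have t3 : 1 - x⁻¹ = - (1 - x) / x := by field_simp; ring
    rw [t1, t3]; field_simp
  rw [e, h.map_inv hF y1', h.map_inv hF x1', hC x x0 x1,
    hC _ (inv_ne_zero x0) (inv_ne_one.2 x1), h.map_inv hF x0] at s1
  linear_combination (norm := module) -s1

lemma card_add_one_smul (h : IsFiveTerm b) (hF : 4 ≤ Fintype.card F) {x : F} (x0 : x ≠ 0) :
    (Fintype.card F + 1) • b x = 0 := by
  classical
  by_cases x1 : x = 1
  · simp [x1, h.map_one]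
  obtain ⟨C, hC⟩ := h.exists_map_one_sub hF
  have hsum : ∀ v : F, v ≠ 0 → v ≠ 1 →
      ∑ y ∈ ((Finset.univ.erase 0).erase 1).erase v, b y
        = ∑ y ∈ Finset.univ.erase (0 : F), b y - b v := by
    intro v v0 v1
    rw [Finset.sum_erase_eq_sub (by simp [v0, v1]), Finset.sum_erase_eq_sub (by simp), h.map_one,
      sub_zero]
  have x1' : 1 - x ≠ 0 := sub_ne_zero.2 (Ne.symm x1)
  have x1'' : x - 1 ≠ 0 := sub_ne_zero.2 x1
  have xi1 : 1 - x⁻¹ ≠ 0 := sub_ne_zero.2 (Ne.symm (inv_ne_one.2 x1))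
  have s1 : ∑ y ∈ ((Finset.univ.erase 0).erase 1).erase x, b (y / x)
      = ∑ y ∈ ((Finset.univ.erase 0).erase 1).erase x⁻¹, b y := by
    refine Finset.sum_nbij' (fun y => y / x) (fun y => y * x) ?_ ?_ ?_ ?_ (fun _ _ => rfl)
    · intro y hy
      simp only [Finset.mem_erase, Finset.mem_univ, and_true] at hy ⊢
      refine ⟨fun e => hy.2.1 ?_, fun e => hy.1 ?_, div_ne_zero hy.2.2 x0⟩
      · field_simp at e; exact e
      · field_simp at e; exact e
    · intro y hy
      simp only [Finset.mem_erase, Finset.mem_univ, and_true] at hy ⊢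
      refine ⟨fun e => hy.2.1 ?_, fun e => hy.1 ?_, mul_ne_zero hy.2.2 x0⟩
      · simpa [x0] using e
      · exact eq_inv_of_mul_eq_one_left e
    · intro y _; field_simp
    · intro y _; field_simp
  have s2 : ∑ y ∈ ((Finset.univ.erase 0).erase 1).erase x, b ((1 - x⁻¹) / (1 - y⁻¹))
      = ∑ y ∈ ((Finset.univ.erase 0).erase 1).erase (1 - x⁻¹), b y := by
    refine Finset.sum_nbij' (fun y => (1 - x⁻¹) / (1 - y⁻¹)) (fun y => (1 - (1 - x⁻¹) / y)⁻¹)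
      ?_ ?_ ?_ ?_ (fun _ _ => rfl)
    · intro y hy
      simp only [Finset.mem_erase, Finset.mem_univ, and_true] at hy ⊢
      obtain ⟨yx, y1, y0⟩ := hy
      have yi1 : 1 - y⁻¹ ≠ 0 := sub_ne_zero.2 (Ne.symm (inv_ne_one.2 y1))
      refine ⟨fun e => ?_, fun e => ?_, div_ne_zero xi1 yi1⟩
      · rw [div_eq_iff yi1] at e
        have := mul_left_cancel₀ xi1 ((mul_one _).trans e)
        exact inv_ne_zero y0 (by linear_combination this)
      · rw [div_eq_iff yi1] at e
        exact yx (inv_injective (by linear_combination e))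
    · intro y hy
      simp only [Finset.mem_erase, Finset.mem_univ, and_true] at hy ⊢
      obtain ⟨yx, y1, y0⟩ := hy
      refine ⟨fun e => ?_, fun e => ?_, inv_ne_zero fun e => ?_⟩
      · have := inv_injective (e.trans (inv_inv x).symm)
        replace this : (1 - x⁻¹) / y = 1 - x⁻¹ := by linear_combination -this
        rw [div_eq_iff y0] at this
        exact y1 (mul_left_cancel₀ xi1 (this.symm.trans (mul_one _).symm))
      · rw [inv_eq_one, sub_eq_self] at e
        exact div_ne_zero xi1 y0 e
      · rw [sub_eq_zero, eq_div_iff y0, one_mul] at e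
        exact yx e
    · intro y hy
      simp only [Finset.mem_erase, Finset.mem_univ, and_true] at hy
      have yi1 : 1 - y⁻¹ ≠ 0 := sub_ne_zero.2 (Ne.symm (inv_ne_one.2 hy.2.1))
      rw [div_div_cancel₀ xi1, sub_sub_cancel, inv_inv]
    · intro y hy
      simp only [Finset.mem_erase, Finset.mem_univ, and_true] at hy
      rw [inv_inv, sub_sub_cancel, div_div_cancel₀ xi1]
  have s3 : ∑ y ∈ ((Finset.univ.erase 0).erase 1).erase x, b ((1 - x) / (1 - y))
      = ∑ y ∈ ((Finset.univ.erase 0).erase 1).erase (1 - x), b y := by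
    refine Finset.sum_nbij' (fun y => (1 - x) / (1 - y)) (fun y => 1 - (1 - x) / y)
      ?_ ?_ ?_ ?_ (fun _ _ => rfl)
    · intro y hy
      simp only [Finset.mem_erase, Finset.mem_univ, and_true] at hy ⊢
      obtain ⟨yx, y1, y0⟩ := hy
      have y1' : 1 - y ≠ 0 := sub_ne_zero.2 (Ne.symm y1)
      refine ⟨fun e => ?_, fun e => ?_, div_ne_zero x1' y1'⟩
      · rw [div_eq_iff y1'] at e
        have := mul_left_cancel₀ x1' ((mul_one _).trans e)
        exact y0 (by linear_combination this)
      · rw [div_eq_iff y1'] at e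
        exact yx (by linear_combination e)
    · intro y hy
      simp only [Finset.mem_erase, Finset.mem_univ, and_true] at hy ⊢
      obtain ⟨yx, y1, y0⟩ := hy
      refine ⟨fun e => ?_, fun e => ?_, fun e => ?_⟩
      · have : (1 - x) / y = 1 - x := by linear_combination -e
        rw [div_eq_iff y0] at this
        exact y1 (mul_left_cancel₀ x1' (this.symm.trans (mul_one _).symm))
      · rw [sub_eq_self] at e
        exact div_ne_zero x1' y0 e
      · rw [sub_eq_zero, eq_div_iff y0, one_mul] at e
        exact yx e
    · intro y hy
      simp only [Finset.mem_erase, Finset.mem_univ, and_true] at hy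
      rw [div_div_cancel₀ x1', sub_sub_cancel]
    · intro y hy
      rw [sub_sub_cancel, div_div_cancel₀ x1']
  have hcard : (((Finset.univ.erase (0 : F)).erase 1).erase x).card = Fintype.card F - 3 := by
    rw [Finset.card_erase_of_mem (by simp [x0, x1]), Finset.card_erase_of_mem (by simp),
      Finset.card_erase_of_mem (by simp), Finset.card_univ]
    omega
  have total : ∑ y ∈ ((Finset.univ.erase (0 : F)).erase 1).erase x,
      (b x - b y + b (y / x) - b ((1 - x⁻¹) / (1 - y⁻¹)) + b ((1 - x) / (1 - y))) = 0 := by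
    refine Finset.sum_eq_zero fun y hy => ?_
    simp only [Finset.mem_erase, Finset.mem_univ, and_true] at hy
    exact h.five_term x y x0 x1 hy.2.2 hy.2.1
  rw [Finset.sum_add_distrib, Finset.sum_sub_distrib, Finset.sum_add_distrib,
    Finset.sum_sub_distrib, s1, s2, s3, hsum x x0 x1,
    hsum _ (inv_ne_zero x0) (inv_ne_one.2 x1), hsum _ xi1 (by simpa using x0),
    hsum _ x1' (by simpa using x0), Finset.sum_const, hcard,
    hC _ (inv_ne_zero x0) (inv_ne_one.2 x1), h.map_inv hF x0, hC x x0 x1] at total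
  obtain ⟨k, hk⟩ : ∃ k, Fintype.card F = k + 3 := ⟨Fintype.card F - 3, by omega⟩
  rw [hk, Nat.add_sub_cancel] at total
  have e : (Fintype.card F + 1) • b x = k • b x + (b x + b x + b x + b x) := by
    rw [hk, show k + 3 + 1 = k + 4 by ring, add_smul]
    congr 1
    abel
  rw [e]
  linear_combination (norm := module) total

end IsFiveTerm

section CyclicCohomology

variable {n : ℕ} [NeZero n] {A : Type*} [AddCommGroup A]

lemma zmod_shift_induction {p : ZMod n → Prop} (h0 : p 0) (h1 : ∀ t, p t → p (t + 1)) (t : ZMod n) :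
    p t := by
  have : ∀ j : ℕ, p (j : ZMod n) := by
    intro j
    induction j with
    | zero => simpa using h0
    | succ j ih => simpa using h1 _ ih
  simpa using this t.val

/-- An invariant homogeneous `3`-cocycle on a cyclic group is an invariant coboundary as soon as it
vanishes on the fundamental `3`-cycle. -/
theorem exists_invariant_primitive (f : ZMod n → ZMod n → ZMod n → ZMod n → A)
    (hinv : ∀ w x y z t, f (w + t) (x + t) (y + t) (z + t) = f w x y z)
    (hf : ∀ v w x y z, f w x y z - f v x y z + f v w y z - f v w x z + f v w x y = 0)
    (h0 : ∑ i, (f 0 1 (i + 1) (i + 1 + 1) - f 0 0 i (i + 1)) = 0) :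
    ∃ g : ZMod n → ZMod n → ZMod n → A,
      (∀ x y z t, g (x + t) (y + t) (z + t) = g x y z) ∧
      ∀ w x y z, f w x y z = g x y z - g w y z + g w x z - g w x y := by
  obtain ⟨k, hk⟩ : ∃ k : ZMod n → ZMod n → A,
    ∀ x y, k x y = f 0 1 (x + 1) (y + 1) - f 0 0 x y := ⟨_, fun _ _ => rfl⟩
  have dh : ∀ w x y z, f w x y z = f 0 x y z - f 0 w y z + f 0 w x z - f 0 w x y := by
    intro w x y z
    linear_combination (norm := module) hf 0 w x y z
  have hH : ∀ x y z, f 0 (x + 1) (y + 1) (z + 1) - f 0 x y z = k y z - k x z + k x y := by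
    intro x y z
    have e := hinv 0 x y z 1
    rw [dh (0 + 1), dh 0 x] at e
    rw [hk, hk, hk, ← sub_eq_zero, ← sub_eq_zero.2 e]
    simp only [zero_add]
    abel
  have hL : ∀ x y z, (∑ i, k (y + i) (z + i)) - (∑ i, k (x + i) (z + i))
      + ∑ i, k (x + i) (y + i) = 0 := by
    intro x y z
    rw [← Finset.sum_sub_distrib, ← Finset.sum_add_distrib]
    simp only [← hH]
    rw [Finset.sum_sub_distrib, sub_eq_zero]
    exact Fintype.sum_equiv (Equiv.addRight 1) _ _ (fun i => by simp [add_assoc])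
  have hLinv : ∀ x y t, (∑ i, k (x + t + i) (y + t + i)) = ∑ i, k (x + i) (y + i) := by
    intro x y t
    exact Fintype.sum_equiv (Equiv.addLeft t) _ _ (fun i => by simp [add_assoc])
  have hl : ∀ y, ∑ i, k (0 + i) (y + i) = 0 := by
    refine zmod_shift_induction ?_ ?_
    · have := hL 0 0 0
      rwa [sub_self, zero_add] at this
    · intro t ht
      have e1 := hL 0 t (t + 1)
      have e2 := hLinv 0 1 t
      have e3 : ∑ i, k (0 + i) (1 + i) = 0 := by
        rw [← h0]
        refine Finset.sum_congr rfl fun i _ => ?_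
        rw [hk, zero_add, add_comm 1 i]
      rw [zero_add, add_comm 1 t] at e2
      rw [e2, e3, ht] at e1
      linear_combination (norm := module) -e1
  have hN : ∀ c, ∑ i, k i (i + c) = 0 := by
    intro c
    rw [← hl c]
    exact Finset.sum_congr rfl fun i _ => by rw [zero_add, add_comm]
  obtain ⟨m, hm⟩ : ∃ m : ZMod n → ZMod n → A,
    ∀ x y, m x y = ∑ i ∈ Finset.range x.val, k i (i + (y - x)) := ⟨_, fun _ _ => rfl⟩
  have hm1 : ∀ x y, m (x + 1) (y + 1) = m x y + k x y := by
    intro x y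
    have hsum : m x y + k x y = ∑ i ∈ Finset.range (x.val + 1), k i (i + (y - x)) := by
      rw [Finset.sum_range_succ, hm, ZMod.natCast_zmod_val, add_sub_cancel]
    rw [hsum, hm, add_sub_add_right_eq_sub]
    by_cases hx : x.val + 1 < n
    · have : (x + 1).val = x.val + 1 := by
        have := ZMod.val_natCast_of_lt hx
        rwa [Nat.cast_add, ZMod.natCast_zmod_val, Nat.cast_one] at this
      rw [this]
    · have hxn : x.val + 1 = n := le_antisymm x.val_lt (not_lt.1 hx)
      have : x + 1 = 0 := by
        have : ((x.val + 1 : ℕ) : ZMod n) = 0 := by rw [hxn, ZMod.natCast_self]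
        rwa [Nat.cast_add, ZMod.natCast_zmod_val, Nat.cast_one] at this
      rw [this, hxn, ZMod.val_zero, Finset.sum_range_zero, ← hN (y - x), eq_comm]
      refine Finset.sum_nbij' (fun i => (i : ZMod n)) (fun i => i.val) ?_ ?_ ?_ ?_ ?_
      · intro i _; simp
      · intro i _; simpa using i.val_lt
      · intro i hi; exact ZMod.val_natCast_of_lt (Finset.mem_range.1 hi)
      · intro i _; simp
      · intro i _; rfl
  refine ⟨fun x y z => f 0 x y z - (m y z - m x z + m x y), ?_, ?_⟩
  · intro x y z
    refine zmod_shift_induction (by simp) ?_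
    intro t ht
    rw [← ht, ← add_assoc, ← add_assoc, ← add_assoc]
    simp only [hm1]
    linear_combination (norm := module) hH (x + t) (y + t) (z + t)
  · intro w x y z
    rw [dh]
    dsimp only
    abel

end CyclicCohomology

section CrossRatio

variable {K : Type*} [Field K]

/-- The cross ratio of four points, normalised by `(0, ∞, 1, x) ↦ x`. -/
def crossRatio (a b c d : K) : K := (d - a) * (c - b) / ((d - b) * (c - a))

lemma crossRatio_congr {a b c d a' b' c' d' u v w x N : K} (hN : N ≠ 0) (hu : u ≠ 0) (hv : v ≠ 0)
    (hw : w ≠ 0) (hx : x ≠ 0)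
    (hda : d' - a' = N * (d - a) / (x * u)) (hcb : c' - b' = N * (c - b) / (w * v))
    (hdb : d' - b' = N * (d - b) / (x * v)) (hca : c' - a' = N * (c - a) / (w * u)) :
    crossRatio a' b' c' d' = crossRatio a b c d := by
  unfold crossRatio
  rw [hda, hcb, hdb, hca]
  have e1 : N * (d - a) / (x * u) * (N * (c - b) / (w * v))
      = (N * N / (x * u * w * v)) * ((d - a) * (c - b)) := by field_simp
  have e2 : N * (d - b) / (x * v) * (N * (c - a) / (w * u))
      = (N * N / (x * u * w * v)) * ((d - b) * (c - a)) := by field_simp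
  rw [e1, e2, mul_div_mul_left]
  positivity

lemma eq_of_crossRatio {a b c d : K} (hab : a ≠ b) (hac : a ≠ c) (hbc : b ≠ c) (hbd : b ≠ d) :
    d = (a * (c - b) - crossRatio a b c d * b * (c - a))
      / ((c - b) - crossRatio a b c d * (c - a)) := by
  have h1 : c - a ≠ 0 := sub_ne_zero.2 hac.symm
  have h2 : c - b ≠ 0 := sub_ne_zero.2 hbc.symm
  have h3 : d - b ≠ 0 := sub_ne_zero.2 hbd.symm
  have h4 : a - b ≠ 0 := sub_ne_zero.2 hab
  have e1 : a * (c - b) - crossRatio a b c d * b * (c - a) = d * ((a - b) * (c - b) / (d - b)) := by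
    unfold crossRatio; field_simp; ring
  have e2 : (c - b) - crossRatio a b c d * (c - a) = (a - b) * (c - b) / (d - b) := by
    unfold crossRatio; field_simp; ring
  rw [e1, e2, mul_div_cancel_right₀]
  exact div_ne_zero (mul_ne_zero h4 h2) h3

end CrossRatio

/-- A field `K` with an involution `bar`, together with a parametrization of the elements of norm
`1` by a cyclic group of order `q + 1`. -/
structure UnitCircle (q : ℕ) (K : Type*) [Field K] where
  bar : K →+* K
  bar_bar : ∀ x, bar (bar x) = x
  e : ZMod (q + 1) → K
  e_add : ∀ i j, e (i + j) = e i * e j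
  e_injective : Function.Injective e
  e_mul_bar : ∀ i, e i * bar (e i) = 1
  exists_e : ∀ u, u * bar u = 1 → ∃ i, e i = u

namespace UnitCircle

variable {q : ℕ} {K : Type*} [Field K] (S : UnitCircle q K)

lemma e_ne_zero (i) : S.e i ≠ 0 := left_ne_zero_of_mul_eq_one (S.e_mul_bar i)

lemma e_zero : S.e 0 = 1 := by
  have := S.e_add 0 0
  rw [add_zero] at this
  exact (mul_eq_left₀ (S.e_ne_zero 0)).1 this.symm

lemma bar_e (i) : S.bar (S.e i) = (S.e i)⁻¹ := eq_inv_of_mul_eq_one_right (S.e_mul_bar i)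

lemma e_neg (i) : S.e (-i) = (S.e i)⁻¹ := by
  refine eq_inv_of_mul_eq_one_left ?_
  rw [← S.e_add, neg_add_cancel, S.e_zero]

lemma e_sub (i j) : S.e (i - j) = S.e i / S.e j := by
  rw [sub_eq_add_neg, S.e_add, S.e_neg, div_eq_mul_inv]

lemma e_ne {i j} (h : i ≠ j) : S.e i ≠ S.e j := fun e => h (S.e_injective e)

/-- The index of an element of norm `1`. -/
noncomputable def log : K → ZMod (q + 1) := Function.invFun S.e

lemma log_e (i) : S.log (S.e i) = i := Function.leftInverse_invFun S.e_injective i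

lemma e_log {u : K} (h : u * S.bar u = 1) : S.e (S.log u) = u := Function.invFun_eq (S.exists_e u h)

lemma bar_crossRatio (i j k l) : S.bar (crossRatio (S.e i) (S.e j) (S.e k) (S.e l))
    = crossRatio (S.e i) (S.e j) (S.e k) (S.e l) := by
  have h : ∀ i j, S.bar (S.e i) - S.bar (S.e j) = (-1) * (S.e i - S.e j) / (S.e i * S.e j) := by
    intro i j
    have := S.e_ne_zero i
    have := S.e_ne_zero j
    rw [S.bar_e, S.bar_e]
    field_simp
    ring
  have : S.bar (crossRatio (S.e i) (S.e j) (S.e k) (S.e l)) = crossRatio (S.bar (S.e i))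
      (S.bar (S.e j)) (S.bar (S.e k)) (S.bar (S.e l)) := by
    simp [crossRatio]
  rw [this]
  exact crossRatio_congr (neg_ne_zero.2 one_ne_zero) (S.e_ne_zero i) (S.e_ne_zero j)
    (S.e_ne_zero k) (S.e_ne_zero l) (h _ _) (h _ _) (h _ _) (h _ _)

lemma crossRatio_e_add (i j k l t) :
    crossRatio (S.e (i + t)) (S.e (j + t)) (S.e (k + t)) (S.e (l + t))
      = crossRatio (S.e i) (S.e j) (S.e k) (S.e l) := by
  have h : ∀ i j, S.e (i + t) - S.e (j + t) = S.e t * (S.e i - S.e j) / (1 * 1) := by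
    intro i j
    rw [S.e_add, S.e_add]
    ring
  exact crossRatio_congr (S.e_ne_zero t) one_ne_zero one_ne_zero one_ne_zero one_ne_zero
    (h _ _) (h _ _) (h _ _) (h _ _)

/-- The points outside the unit circle of the projective line; `none` is the point at infinity.
They parametrize the Möbius transformations of the circle modulo rotations. -/
abbrev Outside : Type _ := Option {τ : K // τ * S.bar τ ≠ 1}

variable {S}

/-- The leading coefficient of the Möbius transformation attached to a point. -/
def alpha : S.Outside → K
  | none => 0
  | some _ => 1

/-- The constant coefficient of the Möbius transformation attached to a point. -/
def beta : S.Outside → K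
  | none => 1
  | some τ => -τ

lemma disc_ne_zero (h : S.Outside) :
    alpha h * S.bar (alpha h) - beta h * S.bar (beta h) ≠ 0 := by
  match h with
  | none => simp [alpha, beta]
  | some τ =>
    simp only [alpha, beta, map_one, map_neg, neg_mul_neg, mul_one]
    exact sub_ne_zero.2 (Ne.symm τ.2)

/-- The denominator of the Möbius transformation attached to a point. -/
def den (h : S.Outside) (u : K) : K := S.bar (beta h) * u + S.bar (alpha h)

lemma num_eq (h : S.Outside) (i) :
    alpha h * S.e i + beta h = S.e i * S.bar (den h (S.e i)) := by
  have := S.e_ne_zero i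
  simp only [den, map_add, map_mul, S.bar_bar, S.bar_e]
  field_simp
  ring

lemma den_ne_zero (h : S.Outside) (i) : den h (S.e i) ≠ 0 := by
  intro h0
  have h1 := num_eq h i
  rw [h0, map_zero, mul_zero] at h1
  unfold den at h0
  have : S.e i * (alpha h * S.bar (alpha h) - beta h * S.bar (beta h)) = 0 := by
    linear_combination S.bar (alpha h) * h1 - beta h * h0
  exact mul_ne_zero (S.e_ne_zero i) (disc_ne_zero h) this

/-- The Möbius transformation attached to a point, as a permutation of the circle. -/
noncomputable def mob (h : S.Outside) (i : ZMod (q + 1)) : ZMod (q + 1) :=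
  S.log ((alpha h * S.e i + beta h) / den h (S.e i))

lemma e_mob (h : S.Outside) (i) : S.e (mob h i) = (alpha h * S.e i + beta h) / den h (S.e i) := by
  refine S.e_log ?_
  have h1 := den_ne_zero h i
  have h2 : S.bar (den h (S.e i)) ≠ 0 := (map_ne_zero _).2 h1
  rw [num_eq, map_div₀, map_mul, S.bar_bar]
  have := S.e_mul_bar i
  field_simp
  exact this

lemma e_mob_sub (h : S.Outside) (i j) : S.e (mob h i) - S.e (mob h j)
    = (alpha h * S.bar (alpha h) - beta h * S.bar (beta h)) * (S.e i - S.e j)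
      / (den h (S.e i) * den h (S.e j)) := by
  rw [e_mob, e_mob, div_sub_div _ _ (den_ne_zero h i) (den_ne_zero h j)]
  congr 1
  unfold den
  ring

lemma mob_injective (h : S.Outside) : Function.Injective (mob h) := by
  intro i j hij
  have := e_mob_sub h i j
  rw [hij, sub_self, eq_comm, div_eq_zero_iff] at this
  rcases this with h1 | h1
  · exact S.e_injective (sub_eq_zero.1 ((mul_eq_zero.1 h1).resolve_left (disc_ne_zero h)))
  · exact absurd h1 (mul_ne_zero (den_ne_zero h i) (den_ne_zero h j))

lemma crossRatio_mob (h : S.Outside) (i j k l) :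
    crossRatio (S.e (mob h i)) (S.e (mob h j)) (S.e (mob h k)) (S.e (mob h l))
      = crossRatio (S.e i) (S.e j) (S.e k) (S.e l) :=
  crossRatio_congr (disc_ne_zero h) (den_ne_zero h i) (den_ne_zero h j) (den_ne_zero h k)
    (den_ne_zero h l) (e_mob_sub h _ _) (e_mob_sub h _ _) (e_mob_sub h _ _) (e_mob_sub h _ _)

lemma mob_none (i) : mob (none : S.Outside) i = -i := by
  refine S.e_injective ?_
  rw [e_mob, S.e_neg]
  simp [alpha, beta, den]

lemma mob_zero (h0 : (0 : K) * S.bar 0 ≠ 1) (i) : mob (some ⟨0, h0⟩ : S.Outside) i = i := by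
  refine S.e_injective ?_
  rw [e_mob]
  simp [alpha, beta, den]

lemma mob_rotate {τ : K} (hτ : τ * S.bar τ ≠ 1) (j) (hj : S.e j * τ * S.bar (S.e j * τ) ≠ 1) (i) :
    mob (some ⟨S.e j * τ, hj⟩ : S.Outside) i = mob (some ⟨τ, hτ⟩ : S.Outside) (i - j) + j := by
  refine S.e_injective ?_
  have h1 := den_ne_zero (some ⟨τ, hτ⟩ : S.Outside) (i - j)
  have h2 := den_ne_zero (some ⟨S.e j * τ, hj⟩ : S.Outside) i
  have h3 := S.e_ne_zero j
  rw [S.e_add, e_mob, e_mob, div_mul_eq_mul_div, div_eq_div_iff h2 h1]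
  simp only [alpha, beta, den, S.e_sub, map_neg, map_mul, S.bar_e, map_one]
  field_simp

lemma quadratic_eq_zero {a b c u v w : K} (huv : u ≠ v) (huw : u ≠ w) (hvw : v ≠ w)
    (hu : a * u ^ 2 + b * u + c = 0) (hv : a * v ^ 2 + b * v + c = 0)
    (hw : a * w ^ 2 + b * w + c = 0) : a = 0 ∧ b = 0 ∧ c = 0 := by
  have h1 : a * (u + v) + b = 0 := by
    refine (mul_eq_zero.1 ?_).resolve_left (sub_ne_zero.2 huv)
    linear_combination hu - hv
  have h2 : a * (u + w) + b = 0 := by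
    refine (mul_eq_zero.1 ?_).resolve_left (sub_ne_zero.2 huw)
    linear_combination hu - hw
  have h3 : a = 0 := by
    refine (mul_eq_zero.1 ?_).resolve_left (sub_ne_zero.2 hvw)
    linear_combination h1 - h2
  subst h3
  have h4 : b = 0 := by linear_combination h1
  subst h4
  exact ⟨rfl, rfl, by linear_combination hu⟩

lemma mob_sub_injective {i j k : ZMod (q + 1)} (hij : i ≠ j) (hik : i ≠ k) (hjk : j ≠ k) :
    Function.Injective fun h : S.Outside => (mob h j - mob h i, mob h k - mob h i) := by
  intro h h' hh
  simp only [Prod.mk.injEq] at hh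
  obtain ⟨h1, h2⟩ := hh
  obtain ⟨l, hl⟩ : ∃ l, l = mob h i - mob h' i := ⟨_, rfl⟩
  have ei : mob h i = l + mob h' i := by rw [hl]; ring
  have ej : mob h j = l + mob h' j := by rw [hl]; linear_combination h1
  have ek : mob h k = l + mob h' k := by rw [hl]; linear_combination h2
  have key : ∀ t, mob h t = l + mob h' t →
      (alpha h * S.bar (beta h') - S.e l * (alpha h' * S.bar (beta h))) * (S.e t) ^ 2
      + (alpha h * S.bar (alpha h') + beta h * S.bar (beta h')
          - S.e l * (alpha h' * S.bar (alpha h) + beta h' * S.bar (beta h))) * S.e t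
      + (beta h * S.bar (alpha h') - S.e l * (beta h' * S.bar (alpha h))) = 0 := by
    intro t ht
    have := congrArg S.e ht
    rw [S.e_add, e_mob, e_mob, mul_div_assoc', div_eq_div_iff (den_ne_zero h t)
      (den_ne_zero h' t)] at this
    unfold den at this
    linear_combination this
  obtain ⟨A, B, C⟩ := quadratic_eq_zero (S.e_ne hij) (S.e_ne hik) (S.e_ne hjk) (key i ei) (key j ej)
    (key k ek)
  match h, h' with
  | none, none => rfl
  | none, some τ => simp [alpha, beta, S.e_ne_zero] at A
  | some τ, none => simp [alpha, beta] at A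
  | some τ, some τ' =>
    simp only [alpha, beta, map_neg, map_one] at A B C
    have h3 : (1 - S.e l) * (1 - τ * S.bar τ) = 0 := by
      linear_combination B + τ * A + S.bar τ * C
    have h4 : 1 - S.e l = 0 :=
      (mul_eq_zero.1 h3).resolve_right (sub_ne_zero.2 (Ne.symm τ.2))
    have : (τ : K) = τ' := by linear_combination -C - τ' * h4
    rw [Subtype.ext this]

variable (S) in
lemma card_outside [Fintype K] [DecidableEq K] (hK : Fintype.card K = q ^ 2) :
    Fintype.card S.Outside = q ^ 2 - q := by
  have h1 : Fintype.card {τ : K // τ * S.bar τ = 1} = q + 1 := by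
    rw [← ZMod.card (q + 1)]
    refine (Fintype.card_of_bijective (f := fun i => (⟨S.e i, S.e_mul_bar i⟩ :
      {τ : K // τ * S.bar τ = 1})) ⟨fun i j hij => ?_, fun u => ?_⟩).symm
    · exact S.e_injective (congrArg Subtype.val hij)
    · obtain ⟨i, hi⟩ := S.exists_e u.1 u.2
      exact ⟨i, Subtype.ext hi⟩
  have h2 := Fintype.card_subtype_compl (fun τ : K => τ * S.bar τ = 1)
  have h3 := Fintype.card_subtype_le (fun τ : K => τ * S.bar τ = 1)
  rw [Fintype.card_option, h2, h1, hK]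
  rw [h1, hK] at h3
  omega

variable [Fintype K] [DecidableEq K] {A : Type*} [AddCommGroup A]

lemma sum_mob_sub (hK : Fintype.card K = q ^ 2) {i j k : ZMod (q + 1)} (hij : i ≠ j)
    (hik : i ≠ k) (hjk : j ≠ k) (G : ZMod (q + 1) → ZMod (q + 1) → A) :
    ∑ h : S.Outside, G (mob h j - mob h i) (mob h k - mob h i)
      = ∑ p ∈ (Finset.univ.erase (0 : ZMod (q + 1))).offDiag, G p.1 p.2 := by
  have himg : Finset.univ.image (fun h : S.Outside => (mob h j - mob h i, mob h k - mob h i))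
      = (Finset.univ.erase (0 : ZMod (q + 1))).offDiag := by
    refine Finset.eq_of_subset_of_card_le ?_ ?_
    · intro p hp
      obtain ⟨h, -, rfl⟩ := Finset.mem_image.1 hp
      have m1 := (mob_injective h).ne hij.symm
      have m2 := (mob_injective h).ne hik.symm
      have m3 := (mob_injective h).ne hjk
      simpa [sub_eq_zero, sub_left_inj] using ⟨m1, m2, m3⟩
    · rw [Finset.card_image_of_injective _ (mob_sub_injective hij hik hjk), Finset.card_univ,
        S.card_outside hK, Finset.offDiag_card, Finset.card_erase_of_mem (Finset.mem_univ _),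
        Finset.card_univ, ZMod.card]
      simp [sq]
  rw [← himg, Finset.sum_image fun a _ b _ hab => mob_sub_injective hij hik hjk hab]

lemma sum_invariant_mob (hK : Fintype.card K = q ^ 2) {i j k : ZMod (q + 1)} (hij : i ≠ j)
    (hik : i ≠ k) (hjk : j ≠ k) {g : ZMod (q + 1) → ZMod (q + 1) → ZMod (q + 1) → A}
    (hg : ∀ x y z t, g (x + t) (y + t) (z + t) = g x y z) :
    ∑ h : S.Outside, g (mob h i) (mob h j) (mob h k)
      = ∑ p ∈ (Finset.univ.erase (0 : ZMod (q + 1))).offDiag, g 0 p.1 p.2 := by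
  rw [← sum_mob_sub (S := S) hK hij hik hjk (g 0)]
  refine Finset.sum_congr rfl fun h _ => ?_
  rw [← hg 0 _ _ (mob h i), zero_add, sub_add_cancel, sub_add_cancel]

variable (S) in
/-- The transfer of a rotation invariant function to the group of Möbius transformations. -/
noncomputable def transfer (f : ZMod (q + 1) → ZMod (q + 1) → ZMod (q + 1) → ZMod (q + 1) → A)
    (i j k l : ZMod (q + 1)) : A :=
  ∑ h : S.Outside, f (mob h i) (mob h j) (mob h k) (mob h l)

variable {f : ZMod (q + 1) → ZMod (q + 1) → ZMod (q + 1) → ZMod (q + 1) → A}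

lemma transfer_eq_of_crossRatio_eq (hK : Fintype.card K = q ^ 2)
    (hinv : ∀ w x y z t, f (w + t) (x + t) (y + t) (z + t) = f w x y z)
    {i j k l i' j' k' l' : ZMod (q + 1)} (hij : i ≠ j) (hik : i ≠ k) (hjk : j ≠ k) (hjl : j ≠ l)
    (hij' : i' ≠ j') (hik' : i' ≠ k') (hjk' : j' ≠ k') (hjl' : j' ≠ l')
    (hcr : crossRatio (S.e i) (S.e j) (S.e k) (S.e l)
      = crossRatio (S.e i') (S.e j') (S.e k') (S.e l')) :
    S.transfer f i j k l = S.transfer f i' j' k' l' := by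
  have key : ∀ {i j k l : ZMod (q + 1)}, i ≠ j → i ≠ k → j ≠ k → j ≠ l → ∀ c,
      crossRatio (S.e i) (S.e j) (S.e k) (S.e l) = c →
      S.transfer f i j k l = ∑ p ∈ (Finset.univ.erase (0 : ZMod (q + 1))).offDiag,
        f 0 p.1 p.2 (S.log ((S.e 0 * (S.e p.2 - S.e p.1) - c * S.e p.1 * (S.e p.2 - S.e 0))
          / ((S.e p.2 - S.e p.1) - c * (S.e p.2 - S.e 0)))) := by
    intro i j k l hij hik hjk hjl c hc
    rw [← sum_mob_sub (S := S) hK hij hik hjk (fun a b => f 0 a b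
      (S.log ((S.e 0 * (S.e b - S.e a) - c * S.e a * (S.e b - S.e 0))
          / ((S.e b - S.e a) - c * (S.e b - S.e 0)))))]
    refine Finset.sum_congr rfl fun h _ => ?_
    have hc' : crossRatio (S.e 0) (S.e (mob h j - mob h i)) (S.e (mob h k - mob h i))
        (S.e (mob h l - mob h i)) = c := by
      rw [← S.crossRatio_e_add _ _ _ _ (mob h i), zero_add, sub_add_cancel, sub_add_cancel,
        sub_add_cancel, crossRatio_mob, hc]
    have inj := mob_injective h
    have := eq_of_crossRatio (a := S.e 0) (b := S.e (mob h j - mob h i))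
      (c := S.e (mob h k - mob h i)) (d := S.e (mob h l - mob h i))
      (S.e_ne (sub_ne_zero.2 (inj.ne hij).symm).symm)
      (S.e_ne (sub_ne_zero.2 (inj.ne hik).symm).symm)
      (S.e_ne (by simpa using inj.ne hjk))
      (S.e_ne (by simpa using inj.ne hjl))
    rw [hc'] at this
    rw [← this, S.log_e, ← hinv 0 _ _ _ (mob h i), zero_add, sub_add_cancel, sub_add_cancel,
      sub_add_cancel]
  rw [key hij hik hjk hjl _ hcr, key hij' hik' hjk' hjl' _ rfl]

end UnitCircle

section Degenerate

variable {I A : Type*} [DecidableEq I] [AddCommGroup A]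

/-- The extension to degenerate tuples of a function of quadruples of distinct points. -/
def degenerateExtension (B : I → I → I → I → A) (C : A) (a b c d : I) : A :=
  if a = b ∨ b = c ∨ c = d then 0
  else if a = c then (if b = d then 0 else -C)
  else if a = d then C
  else if b = d then 0
  else B a b c d

lemma degenerateExtension_of_ne {B : I → I → I → I → A} {C : A} {a b c d : I}
    (h : [a, b, c, d].Nodup) :
    degenerateExtension B C a b c d = B a b c d := by
  simp only [List.nodup_cons, List.mem_cons, List.not_mem_nil, not_or, or_false] at h
  simp [degenerateExtension, h]

lemma degenerateExtension_cocycle {B : I → I → I → I → A} {C : A} (hC : C + C + C = 0)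
    (h01 : ∀ a b c d, [a, b, c, d].Nodup → B b a c d = - B a b c d)
    (h23 : ∀ a b c d, [a, b, c, d].Nodup → B a b d c = - B a b c d)
    (h12 : ∀ a b c d, [a, b, c, d].Nodup → B a c b d = - C - B a b c d)
    (h : ∀ v w x y z, [v, w, x, y, z].Nodup →
      B w x y z - B v x y z + B v w y z - B v w x z + B v w x y = 0) (v w x y z : I) :
    degenerateExtension B C w x y z - degenerateExtension B C v x y z
      + degenerateExtension B C v w y z - degenerateExtension B C v w x z
      + degenerateExtension B C v w x y = 0 := by
  simp only [List.nodup_cons, List.mem_cons, List.not_mem_nil, not_or, or_false,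
    List.nodup_nil, and_true, not_false_eq_true, and_imp] at h01 h23 h12 h
  have key : v ≠ w → v ≠ x → w ≠ x → v = z → w = y → degenerateExtension B C w x y z
      - degenerateExtension B C v x y z + degenerateExtension B C v w y z
      - degenerateExtension B C v w x z + degenerateExtension B C v w x y = 0 := by
    rintro e01 e02 e12 rfl rfl
    simp only [degenerateExtension, e01, e02, e12, e01.symm, e02.symm, e12.symm, or_self, if_true,
      if_false, or_true, true_or]
    linear_combination (norm := module) -hC
  have key' : v ≠ w → v ≠ x → w ≠ x → v = y → w = z → degenerateExtension B C w x y z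
      - degenerateExtension B C v x y z + degenerateExtension B C v w y z
      - degenerateExtension B C v w x z + degenerateExtension B C v w x y = 0 := by
    rintro e01 e02 e12 rfl rfl
    simp only [degenerateExtension, e01, e02, e12, e01.symm, e02.symm, e12.symm, or_self, if_true,
      if_false]
    linear_combination (norm := module) hC
  clear hC
  by_cases e01 : v = w
  · subst e01; simp [degenerateExtension]
  by_cases e12 : w = x
  · subst e12; simp [degenerateExtension]
  by_cases e23 : x = y
  · subst e23; simp [degenerateExtension]
  by_cases e34 : y = z
  · subst e34; simp [degenerateExtension]
  by_cases e02 : v = x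
  · subst e02
    by_cases e13 : w = y
    · subst e13
      by_cases e : v = z <;> by_cases e' : w = z <;> grind [degenerateExtension]
    by_cases e : v = z
    · subst e
      grind [degenerateExtension]
    by_cases e' : w = z
    · subst e'
      grind [degenerateExtension]
    have := h01 v w y z
    grind [degenerateExtension]
  by_cases e13 : w = y
  · subst e13
    by_cases e : v = z
    · exact key e01 e02 e12 e rfl
    by_cases e' : x = z
    · subst e'
      grind [degenerateExtension]
    have := h12 v w x z
    grind [degenerateExtension]
  by_cases e24 : x = z
  · subst e24
    by_cases e : v = y
    · subst e
      grind [degenerateExtension]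
    have := h23 v w x y
    grind [degenerateExtension]
  by_cases e03 : v = y
  · subst e03
    by_cases e : w = z
    · exact key' e01 e02 e12 rfl e
    have := h01 v w x z
    have := h12 w v x z
    grind [degenerateExtension]
  by_cases e14 : w = z
  · subst e14
    have := h12 v w x y
    have := h23 v x w y
    grind [degenerateExtension]
  by_cases e04 : v = z
  · subst e04
    have := h01 v w x y
    have := h12 w v x y
    have := h23 w x v y
    grind [degenerateExtension]
  have := h v w x y z
  grind [degenerateExtension]

end Degenerate

lemma crossRatio_swap_left {K : Type*} [Field K] (a b c d : K) :
    crossRatio b a c d = (crossRatio a b c d)⁻¹ := by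
  rw [crossRatio, crossRatio, inv_div]

lemma crossRatio_swap_right {K : Type*} [Field K] (a b c d : K) :
    crossRatio a b d c = (crossRatio a b c d)⁻¹ := by
  rw [crossRatio, crossRatio, inv_div]
  ring

lemma crossRatio_ne_zero {K : Type*} [Field K] {a b c d : K} (h : [a, b, c, d].Nodup) :
    crossRatio a b c d ≠ 0 := by
  simp only [List.nodup_cons, List.mem_cons, List.not_mem_nil, not_or, or_false,
    List.nodup_nil, and_true, not_false_eq_true] at h
  obtain ⟨⟨hab, hac, had⟩, ⟨hbc, hbd⟩, hcd⟩ := h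
  exact div_ne_zero (mul_ne_zero (sub_ne_zero.2 (Ne.symm had)) (sub_ne_zero.2 (Ne.symm hbc)))
    (mul_ne_zero (sub_ne_zero.2 (Ne.symm hbd)) (sub_ne_zero.2 (Ne.symm hac)))

lemma one_sub_crossRatio {K : Type*} [Field K] {a b c d : K} (h : [a, b, c, d].Nodup) :
    1 - crossRatio a b c d = (d - c) * (b - a) / ((d - b) * (c - a)) := by
  simp only [List.nodup_cons, List.mem_cons, List.not_mem_nil, not_or, or_false,
    List.nodup_nil, and_true, not_false_eq_true] at h
  obtain ⟨⟨hab, hac, had⟩, ⟨hbc, hbd⟩, hcd⟩ := h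
  have h1 := sub_ne_zero.2 (Ne.symm hac)
  have h2 := sub_ne_zero.2 (Ne.symm hbd)
  unfold crossRatio
  field_simp
  ring

lemma crossRatio_ne_one {K : Type*} [Field K] {a b c d : K} (h : [a, b, c, d].Nodup) :
    crossRatio a b c d ≠ 1 := by
  intro h1
  have h2 := one_sub_crossRatio h
  simp only [List.nodup_cons, List.mem_cons, List.not_mem_nil, not_or, or_false,
    List.nodup_nil, and_true, not_false_eq_true] at h
  obtain ⟨⟨hab, hac, had⟩, ⟨hbc, hbd⟩, hcd⟩ := h
  rw [h1, sub_self, eq_comm] at h2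
  exact div_ne_zero (mul_ne_zero (sub_ne_zero.2 (Ne.symm hcd)) (sub_ne_zero.2 (Ne.symm hab)))
    (mul_ne_zero (sub_ne_zero.2 (Ne.symm hbd)) (sub_ne_zero.2 (Ne.symm hac))) h2

lemma crossRatio_swap_middle {K : Type*} [Field K] {a b c d : K} (h : [a, b, c, d].Nodup) :
    crossRatio a c b d = (1 - (crossRatio a b c d)⁻¹)⁻¹ := by
  have h0 := crossRatio_ne_zero h
  have h1 := sub_ne_zero.2 (Ne.symm (crossRatio_ne_one h))
  have h1' := sub_ne_zero.2 (crossRatio_ne_one h)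
  have e1 : (1 - (crossRatio a b c d)⁻¹)⁻¹
      = - crossRatio a b c d / (1 - crossRatio a b c d) := by
    field_simp; ring
  rw [e1, one_sub_crossRatio h]
  simp only [List.nodup_cons, List.mem_cons, List.not_mem_nil, not_or, or_false,
    List.nodup_nil, and_true, not_false_eq_true] at h
  obtain ⟨⟨hab, hac, had⟩, ⟨hbc, hbd⟩, hcd⟩ := h
  have := sub_ne_zero.2 (Ne.symm hac)
  have := sub_ne_zero.2 (Ne.symm hbd)
  have := sub_ne_zero.2 (Ne.symm hcd)
  have := sub_ne_zero.2 (Ne.symm hab)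
  unfold crossRatio
  field_simp
  ring

section FiveTerm

variable {K : Type*} [Field K] {v w x y z : K}

lemma crossRatio_div (h : [v, w, x, y, z].Nodup) :
    crossRatio v w y z = crossRatio v w x z / crossRatio v w x y := by
  simp only [List.nodup_cons, List.mem_cons, List.not_mem_nil, not_or, or_false,
    List.nodup_nil, and_true, not_false_eq_true] at h
  obtain ⟨⟨h01, h02, h03, h04⟩, ⟨h12, h13, h14⟩, ⟨h23, h24⟩, h34⟩ := h
  have := sub_ne_zero.2 (Ne.symm h02)
  have := sub_ne_zero.2 (Ne.symm h03)
  have := sub_ne_zero.2 (Ne.symm h12)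
  have := sub_ne_zero.2 (Ne.symm h13)
  have := sub_ne_zero.2 (Ne.symm h14)
  unfold crossRatio
  field_simp

lemma crossRatio_one_sub_div (h : [v, w, x, y, z].Nodup) :
    crossRatio w x y z = (1 - crossRatio v w x y) / (1 - crossRatio v w x z) := by
  rw [one_sub_crossRatio (h.sublist (by simp)),
    one_sub_crossRatio (h.sublist (by simp))]
  simp only [List.nodup_cons, List.mem_cons, List.not_mem_nil, not_or, or_false,
    List.nodup_nil, and_true, not_false_eq_true] at h
  obtain ⟨⟨h01, h02, h03, h04⟩, ⟨h12, h13, h14⟩, ⟨h23, h24⟩, h34⟩ := h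
  have := sub_ne_zero.2 (Ne.symm h01)
  have := sub_ne_zero.2 (Ne.symm h02)
  have := sub_ne_zero.2 (Ne.symm h13)
  have := sub_ne_zero.2 (Ne.symm h14)
  have := sub_ne_zero.2 (Ne.symm h24)
  unfold crossRatio
  field_simp

lemma crossRatio_one_sub_inv_div (h : [v, w, x, y, z].Nodup) :
    crossRatio v x y z = (1 - (crossRatio v w x y)⁻¹) / (1 - (crossRatio v w x z)⁻¹) := by
  have h1 : [w, v, x, y, z].Nodup := (List.Perm.swap w v _).nodup_iff.1 h
  rw [← crossRatio_swap_left, ← crossRatio_swap_left, ← crossRatio_one_sub_div h1]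

end FiveTerm

namespace UnitCircle

variable {q : ℕ} {F K : Type*} [Field F] [Field K] [Algebra F K] (S : UnitCircle q K)

/-- The base field is the fixed field of the involution. -/
def IsFixedField (F : Type*) [Field F] [Algebra F K] : Prop :=
  ∀ k, S.bar k = k ↔ k ∈ (algebraMap F K).range

variable {S}

lemma IsFixedField.bar_algebraMap (hS : S.IsFixedField F) (x : F) :
    S.bar (algebraMap F K x) = algebraMap F K x := (hS _).2 ⟨x, rfl⟩

variable (S) in
/-- The Cayley transform, from the line over the base field to the unit circle. -/
noncomputable def cayley (θ : K) (x : F) : ZMod (q + 1) :=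
  S.log ((algebraMap F K x - θ) / (algebraMap F K x - S.bar θ))

section Cayley

variable {θ : K} (hS : S.IsFixedField F) (hθ : S.bar θ ≠ θ)

include hS hθ

lemma sub_ne_zero_of_isFixedField (x : F) : algebraMap F K x - θ ≠ 0 := by
  intro h
  exact hθ ((hS _).2 ⟨x, sub_eq_zero.1 h⟩)

lemma sub_bar_ne_zero_of_isFixedField (x : F) : algebraMap F K x - S.bar θ ≠ 0 :=
  sub_ne_zero_of_isFixedField hS (by rw [S.bar_bar]; exact hθ.symm) x

lemma e_cayley (x : F) :
    S.e (S.cayley θ x) = (algebraMap F K x - θ) / (algebraMap F K x - S.bar θ) := by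
  refine S.e_log ?_
  have h1 := sub_ne_zero_of_isFixedField hS hθ x
  have h2 := sub_bar_ne_zero_of_isFixedField hS hθ x
  rw [map_div₀, map_sub, map_sub, S.bar_bar, hS.bar_algebraMap]
  field_simp

lemma cayley_injective : Function.Injective (S.cayley θ : F → ZMod (q + 1)) := by
  intro x y hxy
  have h := congrArg S.e hxy
  rw [e_cayley hS hθ, e_cayley hS hθ, div_eq_div_iff (sub_bar_ne_zero_of_isFixedField hS hθ x)
    (sub_bar_ne_zero_of_isFixedField hS hθ y)] at h
  refine (algebraMap F K).injective (sub_eq_zero.1 ?_)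
  refine (mul_eq_zero.1 ?_).resolve_right (sub_ne_zero.2 hθ)
  linear_combination -h

lemma cayley_ne_zero (x : F) : S.cayley θ x ≠ 0 := by
  intro h
  have h := congrArg S.e h
  rw [e_cayley hS hθ, S.e_zero, div_eq_one_iff_eq (sub_bar_ne_zero_of_isFixedField hS hθ x)] at h
  exact hθ (by linear_combination h)

lemma crossRatio_cayley (x : F) :
    crossRatio (S.e (S.cayley θ (0 : F))) (S.e 0) (S.e (S.cayley θ (1 : F))) (S.e (S.cayley θ x))
      = algebraMap F K x := by
  have h1 := sub_bar_ne_zero_of_isFixedField hS hθ x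
  have h2 := sub_bar_ne_zero_of_isFixedField hS hθ 0
  have h3 := sub_bar_ne_zero_of_isFixedField hS hθ 1
  have h4 := sub_ne_zero.2 hθ
  rw [e_cayley hS hθ, e_cayley hS hθ, e_cayley hS hθ, S.e_zero, crossRatio]
  simp only [map_zero, map_one] at h2 h3 ⊢
  have d1 : (algebraMap F K x - θ) / (algebraMap F K x - S.bar θ) - (0 - θ) / (0 - S.bar θ)
      = algebraMap F K x * (S.bar θ - θ) / ((algebraMap F K x - S.bar θ) * - (0 - S.bar θ)) := by
    field_simp; ring
  have d2 : (algebraMap F K x - θ) / (algebraMap F K x - S.bar θ) - 1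
      = (S.bar θ - θ) / (algebraMap F K x - S.bar θ) := by
    field_simp; ring
  have d3 : (1 - θ) / (1 - S.bar θ) - (0 - θ) / (0 - S.bar θ)
      = (S.bar θ - θ) / ((1 - S.bar θ) * - (0 - S.bar θ)) := by
    field_simp; ring
  have d4 : (1 - θ) / (1 - S.bar θ) - 1 = (S.bar θ - θ) / (1 - S.bar θ) := by
    field_simp; ring
  rw [d1, d2, d3, d4]
  field_simp

lemma nodup_cayley {x : F} (x0 : x ≠ 0) (x1 : x ≠ 1) :
    [S.cayley θ (0 : F), 0, S.cayley θ (1 : F), S.cayley θ x].Nodup := by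
  have := cayley_injective hS hθ
  simp [cayley_ne_zero hS hθ, (cayley_ne_zero hS hθ _).symm, this.eq_iff, x0.symm, x1.symm]

end Cayley

lemma nodup_e {l : List (ZMod (q + 1))} (h : l.Nodup) : (l.map S.e).Nodup :=
  h.map S.e_injective

lemma nodup_mob {h : S.Outside} {l : List (ZMod (q + 1))} (hl : l.Nodup) : (l.map (mob h)).Nodup :=
  hl.map (mob_injective h)

end UnitCircle

namespace UnitCircle

variable {q : ℕ} {F K A : Type*} [Field F] [Field K] [Algebra F K] (S : UnitCircle q K)
  {b : F → A}

/-- A function on the base field as a function of the cross ratio of four points of the circle. -/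
noncomputable def onCrossRatio (b : F → A) (i j k l : ZMod (q + 1)) : A :=
  b (Function.invFun (algebraMap F K) (crossRatio (S.e i) (S.e j) (S.e k) (S.e l)))

variable {S}

lemma onCrossRatio_eq {i j k l : ZMod (q + 1)} {x : F}
    (h : crossRatio (S.e i) (S.e j) (S.e k) (S.e l) = algebraMap F K x) :
    S.onCrossRatio b i j k l = b x := by
  rw [onCrossRatio, h, Function.leftInverse_invFun (algebraMap F K).injective]

lemma IsFixedField.exists_crossRatio (hS : S.IsFixedField F) {i j k l : ZMod (q + 1)}
    (h : [i, j, k, l].Nodup) : ∃ x : F, x ≠ 0 ∧ x ≠ 1 ∧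
      crossRatio (S.e i) (S.e j) (S.e k) (S.e l) = algebraMap F K x := by
  obtain ⟨x, hx⟩ := (hS _).1 (S.bar_crossRatio i j k l)
  have h' : [S.e i, S.e j, S.e k, S.e l].Nodup := S.nodup_e h
  refine ⟨x, ?_, ?_, hx.symm⟩
  · rintro rfl
    exact crossRatio_ne_zero h' (by rw [← hx, map_zero])
  · rintro rfl
    exact crossRatio_ne_one h' (by rw [← hx, map_one])

variable [AddCommGroup A]

lemma degenerateExtension_onCrossRatio_add (C : A) (w x y z t : ZMod (q + 1)) :
    degenerateExtension (S.onCrossRatio b) C (w + t) (x + t) (y + t) (z + t)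
      = degenerateExtension (S.onCrossRatio b) C w x y z := by
  simp only [degenerateExtension, add_left_inj, onCrossRatio, S.crossRatio_e_add]

variable [Fintype F] (hS : S.IsFixedField F) (hb : IsFiveTerm b) (hF : 4 ≤ Fintype.card F)

include hS hb hF in
lemma degenerateExtension_onCrossRatio_cocycle {C : A}
    (hC : ∀ x : F, x ≠ 0 → x ≠ 1 → b (1 - x) = C - b x) (v w x y z : ZMod (q + 1)) :
    degenerateExtension (S.onCrossRatio b) C w x y z
      - degenerateExtension (S.onCrossRatio b) C v x y z
      + degenerateExtension (S.onCrossRatio b) C v w y z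
      - degenerateExtension (S.onCrossRatio b) C v w x z
      + degenerateExtension (S.onCrossRatio b) C v w x y = 0 := by
  refine degenerateExtension_cocycle (hb.three_smul_eq_zero hF hC) ?_ ?_ ?_ ?_ v w x y z
  · intro i j k l h
    obtain ⟨x, x0, x1, hx⟩ := hS.exists_crossRatio h
    rw [onCrossRatio_eq hx, onCrossRatio_eq (x := x⁻¹), hb.map_inv hF x0]
    rw [crossRatio_swap_left, hx, map_inv₀]
  · intro i j k l h
    obtain ⟨x, x0, x1, hx⟩ := hS.exists_crossRatio h
    rw [onCrossRatio_eq hx, onCrossRatio_eq (x := x⁻¹), hb.map_inv hF x0]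
    rw [crossRatio_swap_right, hx, map_inv₀]
  · intro i j k l h
    obtain ⟨x, x0, x1, hx⟩ := hS.exists_crossRatio h
    rw [onCrossRatio_eq hx, onCrossRatio_eq (x := (1 - x⁻¹)⁻¹), hb.map_inv hF,
      hC _ (inv_ne_zero x0) (inv_ne_one.2 x1), hb.map_inv hF x0]
    · abel
    · exact sub_ne_zero.2 (Ne.symm (inv_ne_one.2 x1))
    · rw [crossRatio_swap_middle (S.nodup_e h), hx, map_inv₀, map_sub, map_inv₀, map_one]
  · intro i j k l m h
    obtain ⟨x, x0, x1, hx⟩ := hS.exists_crossRatio (i := i) (j := j) (k := k) (l := l)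
      (h.sublist (by simp))
    obtain ⟨y, y0, y1, hy⟩ := hS.exists_crossRatio (i := i) (j := j) (k := k) (l := m)
      (h.sublist (by simp))
    have h' : [S.e i, S.e j, S.e k, S.e l, S.e m].Nodup := S.nodup_e h
    rw [onCrossRatio_eq hx, onCrossRatio_eq hy, onCrossRatio_eq (x := (1 - x) / (1 - y)),
      onCrossRatio_eq (x := (1 - x⁻¹) / (1 - y⁻¹)), onCrossRatio_eq (x := y / x)]
    · linear_combination (norm := module) hb.five_term x y x0 x1 y0 y1
    · rw [crossRatio_div h', hx, hy]
      simp
    · rw [crossRatio_one_sub_inv_div h', hx, hy]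
      simp
    · rw [crossRatio_one_sub_div h', hx, hy]
      simp

include hS hb hF in
/-- The values of a five term function are, up to a factor `2`, multiples of a single one. -/
theorem exists_two_nsmul_mem_zmultiples [Fintype K] [DecidableEq K]
    (hK : Fintype.card K = q ^ 2) (hq : Fintype.card F = q) {θ : K} (hθ : S.bar θ ≠ θ) :
    ∃ a : A, ∀ x : F, x ≠ 0 → 2 • b x ∈ AddSubgroup.zmultiples a := by
  obtain ⟨C, hC⟩ := hb.exists_map_one_sub hF
  set f := degenerateExtension (S.onCrossRatio b) C with hf
  refine ⟨∑ i, (f 0 1 (i + 1) (i + 1 + 1) - f 0 0 i (i + 1)), ?_⟩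
  set a := ∑ i, (f 0 1 (i + 1) (i + 1 + 1) - f 0 0 i (i + 1)) with ha
  let π := QuotientAddGroup.mk' (AddSubgroup.zmultiples a)
  have hcoc := degenerateExtension_onCrossRatio_cocycle hS hb hF hC
  rw [← hf] at hcoc
  obtain ⟨g, hg, hfg⟩ := exists_invariant_primitive (fun w x y z => π (f w x y z))
    (fun w x y z t => by rw [hf, degenerateExtension_onCrossRatio_add])
    (fun v w x y z => by
      simp only [← map_sub, ← map_add]
      rw [hcoc, map_zero])
    (by
      simp only [← map_sub, ← map_sum]
      exact (QuotientAddGroup.eq_zero_iff _).2 (AddSubgroup.mem_zmultiples a))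
  intro x x0
  by_cases x1 : x = 1
  · simp [x1, hb.map_one, zero_mem]
  rw [← QuotientAddGroup.eq_zero_iff]
  change π (2 • b x) = 0
  have hd := nodup_cayley hS hθ x0 x1
  have hcr := crossRatio_cayley hS hθ x
  revert hd hcr
  generalize S.cayley θ (0 : F) = i, (0 : ZMod (q + 1)) = j, S.cayley θ (1 : F) = k,
    S.cayley θ x = l
  intro hd hcr
  have h1 : S.transfer (fun w x y z => π (f w x y z)) i j k l = (q ^ 2 - q) • π (b x) := by
    rw [← S.card_outside hK, ← Finset.card_univ, ← Finset.sum_const, transfer]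
    refine Finset.sum_congr rfl fun h _ => ?_
    rw [hf, degenerateExtension_of_ne (nodup_mob (h := h) hd), onCrossRatio_eq (x := x)]
    rw [crossRatio_mob, hcr]
  have h2 : S.transfer (fun w x y z => π (f w x y z)) i j k l = 0 := by
    simp only [List.nodup_cons, List.mem_cons, List.not_mem_nil, not_or, or_false,
      List.nodup_nil, and_true, not_false_eq_true] at hd
    obtain ⟨⟨hij, hik, hil⟩, ⟨hjk, hjl⟩, hkl⟩ := hd
    simp only [transfer, hfg, Finset.sum_add_distrib, Finset.sum_sub_distrib]
    rw [sum_invariant_mob hK hij hik hjk hg, sum_invariant_mob hK hij hil hjl hg,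
      sum_invariant_mob hK hik hil hkl hg, sum_invariant_mob hK hjk hjl hkl hg]
    abel
  have h3 : (q + 1) • π (b x) = 0 := by
    rw [← map_nsmul, ← hq, hb.card_add_one_smul hF x0, map_zero]
  rw [h1] at h2
  obtain ⟨r, rfl⟩ : ∃ r, q = r + 2 := ⟨q - 2, by omega⟩
  have e : (r + 2) ^ 2 - (r + 2) = (r + 2 + 1) * r + 2 := by
    rw [show (r + 2) ^ 2 = (r + 2 + 1) * r + 2 + (r + 2) by ring, Nat.add_sub_cancel]
  rw [e, add_smul, mul_comm, mul_smul, h3, smul_zero, zero_add] at h2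
  rw [map_nsmul, h2]

end UnitCircle

section Carry

variable {q : ℕ}

/-- The carry cocycle of the addition of residues modulo `q + 1`. -/
def carry (x y : ZMod (q + 1)) : ℕ := (x.val + y.val) / (q + 1)

lemma mul_carry (x y : ZMod (q + 1)) :
    ((q + 1 : ℕ) : ℤ) * carry x y = x.val + y.val - (x + y).val := by
  rw [ZMod.val_add, carry]
  have := Nat.div_add_mod (x.val + y.val) (q + 1)
  zify at this
  push_cast
  linear_combination this

lemma carry_cocycle (x y z : ZMod (q + 1)) :
    (carry y z : ℤ) - carry (x + y) z + carry x (y + z) - carry x y = 0 := by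
  have h : ((q + 1 : ℕ) : ℤ) ≠ 0 := by positivity
  refine (mul_eq_zero.1 ?_).resolve_left h
  rw [mul_sub, mul_add, mul_sub, mul_carry, mul_carry, mul_carry, mul_carry, add_assoc]
  ring

lemma carry_zero_left (x : ZMod (q + 1)) : carry 0 x = 0 := by
  simp [carry, ZMod.val_lt x]

lemma carry_zero_right (x : ZMod (q + 1)) : carry x 0 = 0 := by
  simp [carry, ZMod.val_lt x]

lemma sum_carry (y : ZMod (q + 1)) : ∑ x, carry x y = y.val := by
  have h : ((q + 1 : ℕ) : ℤ) ≠ 0 := by positivity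
  have := Equiv.sum_comp (Equiv.addRight y) (fun x : ZMod (q + 1) => (x.val : ℤ))
  simp only [Equiv.coe_addRight] at this
  zify
  refine mul_left_cancel₀ h ?_
  simp only [Finset.mul_sum, mul_carry, Finset.sum_sub_distrib, Finset.sum_add_distrib, this]
  simp

variable {m : ℕ} (hmq : m ∣ q + 1)

/-- The homogeneous form of the cup product of the reduction modulo `m` and the carry cocycle. -/
def carryCup (w x y z : ZMod (q + 1)) : ZMod m :=
  ZMod.castHom hmq (ZMod m) (x - w) * carry (y - x) (z - y)

lemma carryCup_add (w x y z t : ZMod (q + 1)) :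
    carryCup hmq (w + t) (x + t) (y + t) (z + t) = carryCup hmq w x y z := by
  simp [carryCup]

lemma carryCup_cocycle (v w x y z : ZMod (q + 1)) :
    carryCup hmq w x y z - carryCup hmq v x y z + carryCup hmq v w y z - carryCup hmq v w x z
      + carryCup hmq v w x y = 0 := by
  have h := congrArg (Int.cast : ℤ → ZMod m) (carry_cocycle (x - w) (y - x) (z - y))
  simp only [sub_add_sub_cancel'] at h
  push_cast at h
  simp only [carryCup, map_sub]
  linear_combination (ZMod.castHom hmq (ZMod m) v - ZMod.castHom hmq (ZMod m) w) * h

lemma carryCup_self_left (w y z : ZMod (q + 1)) : carryCup hmq w w y z = 0 := by simp [carryCup]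

lemma carryCup_self_middle (w x z : ZMod (q + 1)) : carryCup hmq w x x z = 0 := by
  simp [carryCup, carry_zero_left]

lemma carryCup_self_right (w x y : ZMod (q + 1)) : carryCup hmq w x y y = 0 := by
  simp [carryCup, carry_zero_right]

lemma sum_carryCup (hq : 1 ≤ q) : ∑ i, carryCup hmq 0 1 i (i + 1) = 1 := by
  have := Equiv.sum_comp (Equiv.subRight (1 : ZMod (q + 1))) (fun x => (carry x 1 : ZMod m))
  simp only [Equiv.subRight_apply] at this
  have h1 : (1 : ZMod (q + 1)).val = 1 := by
    obtain ⟨r, rfl⟩ : ∃ r, q = r + 1 := ⟨q - 1, by omega⟩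
    exact ZMod.val_one'' (by omega)
  simp only [carryCup, add_sub_cancel_left, sub_zero, map_one, one_mul, this]
  rw [← Nat.cast_sum, sum_carry, h1, Nat.cast_one]

lemma sum_carryCup_neg : ∑ i, carryCup hmq (-0) (-1) (-i) (-(i + 1)) = 1 := by
  have := Equiv.sum_comp (Equiv.subLeft (1 : ZMod (q + 1))) (fun x => (carry x (-1) : ZMod m))
  simp only [Equiv.subLeft_apply] at this
  have h2 : ((q + 1 : ℕ) : ZMod m) = 0 := (ZMod.natCast_eq_zero_iff _ _).2 hmq
  push_cast at h2
  have e1 : ∀ i : ZMod (q + 1), -i - -1 = 1 - i := fun i => by ring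
  have e2 : ∀ i : ZMod (q + 1), -(i + 1) - -i = -1 := fun i => by ring
  simp only [carryCup, e1, e2, neg_zero, sub_zero, map_neg, map_one, ← Finset.mul_sum, this]
  rw [← Nat.cast_sum, sum_carry, ZMod.val_neg_one]
  linear_combination -h2

lemma sum_sum_carryCup (s : ZMod (q + 1) → ZMod (q + 1)) :
    ∑ j, ∑ i, carryCup hmq (s j) (s (j + 1)) (s i) (s (i + 1)) = 0 := by
  have tel : ∀ φ : ZMod (q + 1) → ZMod m, ∑ j, φ (j + 1) = ∑ j, φ j := fun φ =>
    Equiv.sum_comp (Equiv.addRight 1) φ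
  have h : ∀ w x y z, carryCup hmq w x y z = carryCup hmq 0 x y z - carryCup hmq 0 w y z
      + carryCup hmq 0 w x z - carryCup hmq 0 w x y := fun w x y z => by
    linear_combination carryCup_cocycle hmq 0 w x y z
  have e1 : ∑ j, ∑ i, carryCup hmq 0 (s (j + 1)) (s i) (s (i + 1))
      = ∑ j, ∑ i, carryCup hmq 0 (s j) (s i) (s (i + 1)) :=
    tel fun j => ∑ i, carryCup hmq 0 (s j) (s i) (s (i + 1))
  have e2 : ∑ j, ∑ i, carryCup hmq 0 (s j) (s (j + 1)) (s (i + 1))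
      = ∑ j, ∑ i, carryCup hmq 0 (s j) (s (j + 1)) (s i) :=
    Finset.sum_congr rfl fun j _ => tel fun i => carryCup hmq 0 (s j) (s (j + 1)) (s i)
  simp only [fun j i => h (s j) (s (j + 1)) (s i) (s (i + 1)), Finset.sum_add_distrib,
    Finset.sum_sub_distrib, e1, e2]
  ring

end Carry

namespace UnitCircle

variable {q m : ℕ} {F K : Type*} [Field F] [Field K] [Algebra F K] {S : UnitCircle q K}
  [Fintype K] [DecidableEq K] {hmq : m ∣ q + 1}

lemma transfer_carryCup_cocycle (v w x y z : ZMod (q + 1)) :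
    S.transfer (carryCup hmq) w x y z - S.transfer (carryCup hmq) v x y z
      + S.transfer (carryCup hmq) v w y z - S.transfer (carryCup hmq) v w x z
      + S.transfer (carryCup hmq) v w x y = 0 := by
  simp only [transfer, ← Finset.sum_sub_distrib, ← Finset.sum_add_distrib, carryCup_cocycle,
    Finset.sum_const_zero]

lemma transfer_carryCup_self_left (w y z : ZMod (q + 1)) :
    S.transfer (carryCup hmq) w w y z = 0 := by
  simp [transfer, carryCup_self_left]

lemma transfer_carryCup_self_middle (w x z : ZMod (q + 1)) :
    S.transfer (carryCup hmq) w x x z = 0 := by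
  simp [transfer, carryCup_self_middle]

lemma transfer_carryCup_self_right (w x y : ZMod (q + 1)) :
    S.transfer (carryCup hmq) w x y y = 0 := by
  simp [transfer, carryCup_self_right]

lemma transfer_carryCup_eq (hK : Fintype.card K = q ^ 2) {x a b x' a' b' : ZMod (q + 1)}
    (h1 : x ≠ a) (h2 : x ≠ b) (h3 : a ≠ b) (h1' : x' ≠ a') (h2' : x' ≠ b') (h3' : a' ≠ b') :
    S.transfer (carryCup hmq) x a x b = S.transfer (carryCup hmq) x' a' x' b' := by
  have hg : ∀ x y z t, carryCup hmq (x + t) (y + t) (x + t) (z + t) = carryCup hmq x y x z :=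
    fun x y z t => carryCup_add hmq x y x z t
  rw [transfer, transfer, sum_invariant_mob (g := fun x y z => carryCup hmq x y x z) hK h1 h2 h3 hg,
    sum_invariant_mob (g := fun x y z => carryCup hmq x y x z) hK h1' h2' h3' hg]

variable (hK : Fintype.card K = q ^ 2) (hq : 4 ≤ q)

include hq in
lemma exists_not_mem_of_card_le_three (s : Finset (ZMod (q + 1))) (hs : s.card ≤ 3) :
    ∃ c, c ∉ s := by
  by_contra! h
  have := Finset.card_le_card (fun x _ => h x : Finset.univ ⊆ s)
  rw [Finset.card_univ, ZMod.card] at this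
  omega

include hK hq in
lemma transfer_carryCup_alternating {x a : ZMod (q + 1)} (h1 : x ≠ a) :
    S.transfer (carryCup hmq) x a x a = 0 := by
  obtain ⟨b, hb⟩ := exists_not_mem_of_card_le_three hq {x, a} (Finset.card_le_two.trans (by simp))
  simp only [Finset.mem_insert, Finset.mem_singleton, not_or] at hb
  have h := transfer_carryCup_cocycle (S := S) (hmq := hmq) x a x a b
  rw [transfer_carryCup_self_left, transfer_carryCup_self_middle,
    transfer_carryCup_eq hK h1.symm (Ne.symm hb.2) (Ne.symm hb.1) h1 (Ne.symm hb.1)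
      (Ne.symm hb.2)] at h
  linear_combination h

include hK hq in
lemma transfer_carryCup_mem_of_nodup {R : AddSubgroup (ZMod m)}
    (hR : ∀ i j k l, [i, j, k, l].Nodup → S.transfer (carryCup hmq) i j k l ∈ R)
    {x a b : ZMod (q + 1)} (h : [x, a, b].Nodup) : S.transfer (carryCup hmq) x a b x ∈ R := by
  simp only [List.nodup_cons, List.mem_cons, List.not_mem_nil, not_or, or_false,
    List.nodup_nil, and_true, not_false_eq_true] at h hR
  obtain ⟨⟨hxa, hxb⟩, hab⟩ := h
  obtain ⟨c, hc⟩ := exists_not_mem_of_card_le_three hq {x, a, b} Finset.card_le_three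
  simp only [Finset.mem_insert, Finset.mem_singleton, not_or] at hc
  obtain ⟨hcx, hca, hcb⟩ := hc
  have h := transfer_carryCup_cocycle (S := S) (hmq := hmq) x a b x c
  rw [transfer_carryCup_eq hK hxb (Ne.symm hcx) (Ne.symm hcb) hxa (Ne.symm hcx) (Ne.symm hca)] at h
  have e : S.transfer (carryCup hmq) x a b x
      = S.transfer (carryCup hmq) x a b c - S.transfer (carryCup hmq) a b x c := by
    linear_combination h
  rw [e]
  refine R.sub_mem (hR _ _ _ _ ?_) (hR _ _ _ _ ?_) <;> grind

include hK hq in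
lemma transfer_carryCup_mem {R : AddSubgroup (ZMod m)}
    (hR : ∀ i j k l, [i, j, k, l].Nodup → S.transfer (carryCup hmq) i j k l ∈ R)
    (i : ZMod (q + 1)) : S.transfer (carryCup hmq) 0 1 i (i + 1) ∈ R := by
  have h01 : (0 : ZMod (q + 1)) ≠ 1 := by
    have : Fact (1 < q + 1) := ⟨by omega⟩
    exact zero_ne_one
  by_cases h0 : i = 0
  · rw [h0, zero_add, transfer_carryCup_alternating hK hq h01]
    exact R.zero_mem
  by_cases h1 : i = 1
  · rw [h1, transfer_carryCup_self_middle]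
    exact R.zero_mem
  by_cases h2 : i + 1 = 0
  · rw [h2]
    refine transfer_carryCup_mem_of_nodup hK hq hR ?_
    simp [h01, Ne.symm h0, Ne.symm h1]
  refine hR _ _ _ _ ?_
  have h3 : i ≠ i + 1 := by simp [h01.symm]
  have h4 : 1 ≠ i + 1 := by simpa [eq_comm] using h0
  simp [h01, Ne.symm h0, Ne.symm h1, Ne.symm h2, h3, h4]

lemma sum_rotate_mob_carryCup :
    ∑ τ : {τ : K // τ * S.bar τ ≠ 1} with τ.1 ≠ 0, ∑ i, carryCup hmq (mob (some τ : S.Outside) 0)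
      (mob (some τ : S.Outside) 1) (mob (some τ : S.Outside) i) (mob (some τ : S.Outside) (i + 1))
      = 0 := by
  rw [← Finset.sum_fiberwise _ fun τ : {τ : K // τ * S.bar τ ≠ 1} => τ.1 * S.bar τ.1]
  refine Finset.sum_eq_zero fun ν _ => ?_
  by_cases hν : ∃ τ : {τ : K // τ * S.bar τ ≠ 1}, τ.1 ≠ 0 ∧ τ.1 * S.bar τ.1 = ν
  swap
  · rw [Finset.sum_eq_zero]
    intro τ hτ
    simp only [Finset.mem_filter, Finset.mem_univ, true_and] at hτ
    exact absurd ⟨τ, hτ⟩ hν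
  obtain ⟨⟨τ, h⟩, h0, h1⟩ := hν
  dsimp only at h0 h1
  have hn : ∀ j, S.e j * τ * S.bar (S.e j * τ) = τ * S.bar τ := fun j => by
    rw [map_mul]
    linear_combination (τ * S.bar τ) * S.e_mul_bar j
  have hr : ∀ j, S.e j * τ * S.bar (S.e j * τ) ≠ 1 := fun j => by rwa [hn]
  have hb0 : S.bar τ ≠ 0 := (map_ne_zero _).2 h0
  rw [← sum_sum_carryCup hmq (mob (some ⟨τ, h⟩ : S.Outside))]
  symm
  refine Finset.sum_bij (fun j _ => ⟨S.e (-j) * τ, hr (-j)⟩) ?_ ?_ ?_ ?_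
  · intro j _
    simp only [Finset.mem_filter, Finset.mem_univ, true_and]
    exact ⟨mul_ne_zero (S.e_ne_zero _) h0, by rw [hn, h1]⟩
  · intro j _ j' _ hjj
    have := mul_right_cancel₀ h0 (congrArg Subtype.val hjj)
    exact neg_injective (S.e_injective this)
  · intro σ hσ
    simp only [Finset.mem_filter, Finset.mem_univ, true_and] at hσ
    obtain ⟨j, hj⟩ := S.exists_e (σ.1 / τ) (by
      rw [map_div₀, div_mul_div_comm, hσ.2, h1, div_self]
      rw [← h1]
      exact mul_ne_zero h0 hb0)
    refine ⟨-j, Finset.mem_univ _, Subtype.ext ?_⟩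
    change S.e (- -j) * τ = σ.1
    rw [neg_neg, hj, div_mul_cancel₀ _ h0]
  · intro j _
    have := Equiv.sum_comp (Equiv.addRight j) fun i => carryCup hmq
      (mob (some ⟨τ, h⟩ : S.Outside) j) (mob (some ⟨τ, h⟩ : S.Outside) (j + 1))
      (mob (some ⟨τ, h⟩ : S.Outside) i) (mob (some ⟨τ, h⟩ : S.Outside) (i + 1))
    rw [← this]
    refine Finset.sum_congr rfl fun i _ => ?_
    simp only [mob_rotate h (-j) (hr (-j)), carryCup_add, sub_neg_eq_add, zero_add,
      Equiv.coe_addRight, add_right_comm, add_comm 1 j]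

include hq in
lemma sum_transfer_carryCup : ∑ i, S.transfer (carryCup hmq) 0 1 i (i + 1) = 2 := by
  simp only [transfer]
  rw [Finset.sum_comm, Fintype.sum_option]
  simp only [mob_none]
  rw [sum_carryCup_neg, ← Finset.sum_filter_add_sum_filter_not _
    fun τ : {τ : K // τ * S.bar τ ≠ 1} => τ.1 ≠ 0, sum_rotate_mob_carryCup]
  have h0 : (0 : K) * S.bar 0 ≠ 1 := by simp
  rw [Finset.sum_eq_single_of_mem ⟨0, h0⟩ (by simp)]
  · simp only [mob_zero, sum_carryCup hmq (show 1 ≤ q by omega)]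
    ring
  · intro τ h1 h2
    simp only [Finset.mem_filter, Finset.mem_univ, true_and, not_not] at h1
    exact absurd (Subtype.ext h1) h2

include hK hq in
/-- There is a surjective five term function with values in `ZMod m`. -/
theorem exists_five_term_zmod (hS : S.IsFixedField F) {θ : K} (hθ : S.bar θ ≠ θ) (hm : Odd m)
    (hmq : m ∣ q + 1) : ∃ ψ : F → ZMod m, ψ 1 = 0 ∧
      (∀ x y : F, x ≠ 0 → x ≠ 1 → y ≠ 0 → y ≠ 1 →
        ψ x - ψ y + ψ (y / x) - ψ ((1 - x⁻¹) / (1 - y⁻¹)) + ψ ((1 - x) / (1 - y)) = 0) ∧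
      ∀ R : AddSubgroup (ZMod m), (∀ x, x ≠ 0 → ψ x ∈ R) → R = ⊤ := by
  let ψ : F → ZMod m := fun x => S.transfer (carryCup hmq) (S.cayley θ (0 : F)) 0
    (S.cayley θ (1 : F)) (S.cayley θ x)
  have h1 : ψ 1 = 0 := transfer_carryCup_self_right _ _ _
  have hψ : ∀ {i j k l x}, [i, j, k, l].Nodup →
      crossRatio (S.e i) (S.e j) (S.e k) (S.e l) = algebraMap F K x →
      S.transfer (carryCup hmq) i j k l = ψ x := by
    intro i j k l x hd hx
    have hx' := hx
    obtain ⟨x', x0, x1, hx''⟩ := hS.exists_crossRatio hd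
    obtain rfl := (algebraMap F K).injective (hx.symm.trans hx'')
    rw [← crossRatio_cayley hS hθ x] at hx
    have hd' := nodup_cayley hS hθ x0 x1
    simp only [List.nodup_cons, List.mem_cons, List.not_mem_nil, not_or, or_false,
      List.nodup_nil, and_true, not_false_eq_true] at hd hd'
    exact transfer_eq_of_crossRatio_eq hK (carryCup_add hmq) hd.1.1 hd.1.2.1 hd.2.1.1 hd.2.1.2
      hd'.1.1 hd'.1.2.1 hd'.2.1.1 hd'.2.1.2 hx
  refine ⟨ψ, h1, fun x y x0 x1 y0 y1 => ?_, fun R hR => ?_⟩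
  · by_cases hxy : x = y
    · subst hxy
      rw [div_self x0, div_self (sub_ne_zero.2 (Ne.symm x1)),
        div_self (sub_ne_zero.2 (Ne.symm (inv_ne_one.2 x1))), h1]
      ring
    have hinj := cayley_injective hS hθ
    have hd : [S.cayley θ (0 : F), 0, S.cayley θ (1 : F), S.cayley θ x, S.cayley θ y].Nodup := by
      simp [cayley_ne_zero hS hθ, (cayley_ne_zero hS hθ _).symm, hinj.eq_iff, x0.symm, x1.symm,
        y0.symm, y1.symm, hxy]
    have hd' := S.nodup_e hd
    have h := transfer_carryCup_cocycle (S := S) (hmq := hmq) (S.cayley θ (0 : F)) 0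
      (S.cayley θ (1 : F)) (S.cayley θ x) (S.cayley θ y)
    rw [hψ (x := (1 - x) / (1 - y)) (hd.sublist (by simp)),
      hψ (x := (1 - x⁻¹) / (1 - y⁻¹)) (hd.sublist (by simp)),
      hψ (x := y / x) (hd.sublist (by simp))] at h
    · linear_combination h
    · rw [crossRatio_div hd', crossRatio_cayley hS hθ, crossRatio_cayley hS hθ, map_div₀]
    · rw [crossRatio_one_sub_inv_div hd', crossRatio_cayley hS hθ, crossRatio_cayley hS hθ]
      simp
    · rw [crossRatio_one_sub_div hd', crossRatio_cayley hS hθ, crossRatio_cayley hS hθ]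
      simp
  · have hR' : ∀ i j k l, [i, j, k, l].Nodup → S.transfer (carryCup hmq) i j k l ∈ R := by
      intro i j k l hd
      obtain ⟨x, x0, -, hx⟩ := hS.exists_crossRatio hd
      rw [hψ hd hx]
      exact hR x x0
    have h2 : (2 : ZMod m) ∈ R := by
      rw [← sum_transfer_carryCup (S := S) (hmq := hmq) hq]
      exact R.sum_mem fun i _ => transfer_carryCup_mem hK hq hR' i
    obtain ⟨r, rfl⟩ := hm
    have h3 : (1 : ZMod (2 * r + 1)) ∈ R := by
      have e : ((2 * r + 1 : ℕ) : ZMod (2 * r + 1)) = 0 := ZMod.natCast_self _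
      push_cast at e
      have : (1 : ZMod (2 * r + 1)) = -(r • 2) := by
        rw [nsmul_eq_mul]
        linear_combination e
      rw [this]
      exact R.neg_mem (R.nsmul_mem h2 r)
    refine (AddSubgroup.eq_top_iff' _).2 fun x => ?_
    rw [← ZMod.natCast_zmod_val x, ← nsmul_one]
    exact R.nsmul_mem h3 _

end UnitCircle

open Polynomial in
lemma mem_range_algebraMap_of_pow_card_eq {F K : Type*} [Field F] [Fintype F] [Field K]
    [Algebra F K] {k : K} (hk : k ^ Fintype.card F = k) : k ∈ (algebraMap F K).range := by
  classical
  have hq : 1 < Fintype.card F := Fintype.one_lt_card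
  have h0 : (X ^ Fintype.card F - X : K[X]) ≠ 0 := FiniteField.X_pow_card_sub_X_ne_zero K hq
  have hsub : Finset.univ.image (algebraMap F K) ⊆
      (X ^ Fintype.card F - X : K[X]).roots.toFinset := by
    intro y hy
    obtain ⟨x, -, rfl⟩ := Finset.mem_image.1 hy
    simp [h0, ← map_pow, FiniteField.pow_card]
  have heq := Finset.eq_of_subset_of_card_le hsub (by
    rw [Finset.card_image_of_injective _ (algebraMap F K).injective, Finset.card_univ]
    refine (Multiset.toFinset_card_le _).trans ((card_roots' _).trans ?_)
    rw [FiniteField.X_pow_card_sub_X_natDegree_eq K hq])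
  have : k ∈ Finset.univ.image (algebraMap F K) := by
    rw [heq]
    simp [h0, hk]
  obtain ⟨x, -, rfl⟩ := Finset.mem_image.1 this
  exact ⟨x, rfl⟩

theorem exists_unitCircle {F K : Type*} [Field F] [Fintype F] [Field K] [Fintype K] [Algebra F K]
    (hK : Fintype.card K = Fintype.card F ^ 2) :
    ∃ S : UnitCircle (Fintype.card F) K, S.IsFixedField F := by
  obtain ⟨r, hr⟩ : ∃ r, Fintype.card F = r + 2 :=
    ⟨Fintype.card F - 2, by have : 1 < Fintype.card F := Fintype.one_lt_card; omega⟩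
  obtain ⟨g, hg⟩ := IsCyclic.exists_ofOrder_eq_natCard (α := Kˣ)
  have hcard : orderOf g = (r + 1) * (Fintype.card F + 1) := by
    rw [hg, Nat.card_units, Nat.card_eq_fintype_card, hK, hr]
    refine Nat.sub_eq_of_eq_add ?_
    ring
  have hζ : IsPrimitiveRoot ((g ^ (r + 1) : Kˣ) : K) (Fintype.card F + 1) :=
    IsPrimitiveRoot.coe_units_iff.2
      ((IsPrimitiveRoot.orderOf g).pow (by rw [hcard]; positivity) hcard)
  set ζ : K := ((g ^ (r + 1) : Kˣ) : K)
  refine ⟨{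
    bar := (FiniteField.frobeniusAlgHom F K : K →+* K)
    bar_bar := fun x => ?_
    e := fun i => ζ ^ i.val
    e_add := fun i j => ?_
    e_injective := fun i j hij => ?_
    e_mul_bar := fun i => ?_
    exists_e := fun u hu => ?_ }, fun k => ⟨fun hk => ?_, ?_⟩⟩
  · simp only [RingHom.coe_coe, FiniteField.coe_frobeniusAlgHom]
    rw [← pow_mul, ← sq, ← hK, FiniteField.pow_card]
  · rw [ZMod.val_add, ← pow_add]
    conv_rhs => rw [← Nat.div_add_mod (i.val + j.val) (Fintype.card F + 1), pow_add, pow_mul,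
      hζ.pow_eq_one, one_pow, one_mul]
  · exact ZMod.val_injective _ (hζ.pow_inj (ZMod.val_lt i) (ZMod.val_lt j) hij)
  · simp only [RingHom.coe_coe, FiniteField.coe_frobeniusAlgHom]
    rw [← pow_mul, ← pow_add, ← mul_one_add, mul_comm, pow_mul, add_comm, hζ.pow_eq_one, one_pow]
  · simp only [RingHom.coe_coe, FiniteField.coe_frobeniusAlgHom] at hu
    rw [← pow_succ'] at hu
    obtain ⟨i, hi, rfl⟩ := hζ.eq_pow_of_pow_eq_one hu
    exact ⟨i, by rw [ZMod.val_natCast, Nat.mod_eq_of_lt hi]⟩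
  · exact mem_range_algebraMap_of_pow_card_eq hk
  · rintro ⟨x, rfl⟩
    exact (FiniteField.frobeniusAlgHom F K).commutes x

lemma exists_quadratic_extension (F : Type) [Field F] [Fintype F] :
    ∃ (K : Type) (_ : Field K) (_ : Fintype K) (_ : Algebra F K),
      Fintype.card K = Fintype.card F ^ 2 := by
  obtain ⟨p, hp⟩ := CharP.exists F
  have := Fact.mk (CharP.char_is_prime F p)
  let := Fintype.ofFinite (FiniteField.Extension F p 2)
  refine ⟨FiniteField.Extension F p 2, inferInstance, inferInstance, inferInstance, ?_⟩
  rw [← Nat.card_eq_fintype_card, ← Nat.card_eq_fintype_card]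
  exact FiniteField.natCard_extension F p 2

lemma exists_bar_ne {F K : Type*} [Field F] [Fintype F] [Field K] [Fintype K] [Algebra F K]
    (hK : Fintype.card K = Fintype.card F ^ 2) {q : ℕ} {S : UnitCircle q K}
    (hS : S.IsFixedField F) : ∃ θ, S.bar θ ≠ θ := by
  by_contra! h
  have hsurj : Function.Surjective (algebraMap F K) := fun k => (hS k).1 (h k)
  have := Fintype.card_le_of_surjective _ hsurj
  have : 1 < Fintype.card F := Fintype.one_lt_card
  nlinarith

/-- The element `1 / 2` of `ℤ[1/2]`. -/
def zhalfHalf : Zhalf := ⟨2⁻¹, Subring.subset_closure rfl⟩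

lemma zhalfHalf_add_self : zhalfHalf + zhalfHalf = 1 :=
  Subtype.ext (by change (2 : ℚ)⁻¹ + 2⁻¹ = 1; norm_num)

lemma exists_two_pow_mul_eq_intCast (r : Zhalf) : ∃ (j : ℕ) (k : ℤ), r * 2 ^ j = k := by
  obtain ⟨r, hr⟩ := r
  suffices ∃ (j : ℕ) (k : ℤ), r * 2 ^ j = k by
    obtain ⟨j, k, h⟩ := this
    exact ⟨j, k, Subtype.ext (by push_cast; exact h)⟩
  induction hr using Subring.closure_induction with
  | mem x hx =>
    obtain rfl : x = 2⁻¹ := hx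
    exact ⟨1, 1, by norm_num⟩
  | zero => exact ⟨0, 0, by simp⟩
  | one => exact ⟨0, 1, by simp⟩
  | add x y _ _ hx hy =>
    obtain ⟨j, k, h⟩ := hx
    obtain ⟨j', k', h'⟩ := hy
    refine ⟨j + j', k * 2 ^ j' + k' * 2 ^ j, ?_⟩
    push_cast
    rw [← h, ← h']
    ring
  | neg x _ hx =>
    obtain ⟨j, k, h⟩ := hx
    exact ⟨j, -k, by push_cast; rw [← h]; ring⟩
  | mul x y _ _ hx hy =>
    obtain ⟨j, k, h⟩ := hx
    obtain ⟨j', k', h'⟩ := hy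
    refine ⟨j + j', k * k', ?_⟩
    push_cast
    rw [← h, ← h']
    ring

instance : IsLocalization.Away (2 : ℤ) Zhalf := by
  refine IsLocalization.Away.mk _ ?_ (fun r => ?_) fun a b hab => ⟨0, ?_⟩
  · refine IsUnit.of_mul_eq_one zhalfHalf ?_
    rw [map_ofNat, two_mul, zhalfHalf_add_self]
  · obtain ⟨j, k, h⟩ := exists_two_pow_mul_eq_intCast r
    exact ⟨j, k, by simpa using h⟩
  · have := congrArg Subtype.val hab
    simp only [eq_intCast, SubringClass.coe_intCast, Int.cast_inj] at this
    rw [this]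

lemma exists_zhalf_ringHom {m : ℕ} (hm : Odd m) : Nonempty (Zhalf →+* ZMod m) := by
  have h : IsUnit (Int.castRingHom (ZMod m) 2) := by
    have := (ZMod.isUnit_iff_coprime 2 m).2 (Nat.coprime_two_left.2 hm)
    simpa using this
  exact ⟨IsLocalization.Away.lift (2 : ℤ) h⟩

section Half

variable {M : Type} [AddCommGroup M]

lemma half_eq_zero_of_add_self (t : Half M) (h : t + t = 0) : t = 0 := by
  let μ : Half M →+ Half M := (LinearMap.lTensor M (LinearMap.mulLeft ℤ zhalfHalf)).toAddMonoidHom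
  have key : ∀ t, μ t + μ t = t := fun t => by
    induction t using TensorProduct.induction_on with
    | zero => rw [map_zero, add_zero]
    | add x y hx hy =>
      rw [map_add, add_add_add_comm, hx, hy]
    | tmul p r =>
      change p ⊗ₜ[ℤ] (zhalfHalf * r) + p ⊗ₜ[ℤ] (zhalfHalf * r) = p ⊗ₜ[ℤ] r
      rw [← TensorProduct.tmul_add, ← add_mul, zhalfHalf_add_self, one_mul]
  rw [← key t, ← map_add, h, map_zero]

lemma half_eq_zero_of_two_pow_nsmul (s : ℕ) (t : Half M) (h : 2 ^ s • t = 0) : t = 0 := by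
  induction s with
  | zero => simpa using h
  | succ s ih =>
    refine ih (half_eq_zero_of_add_self _ ?_)
    rwa [← two_nsmul, ← mul_nsmul, ← pow_succ]

lemma mem_of_coprime_nsmul_mem {A : Type*} [AddCommGroup A] {H : AddSubgroup A} {c m : ℕ}
    (h : Nat.Coprime c m) {t : A} (hm : m • t = 0) (hc : c • t ∈ H) : t ∈ H := by
  obtain ⟨u, v, huv⟩ := Nat.isCoprime_iff_coprime.2 h
  have : t = u • c • t + v • m • t := by
    rw [← natCast_zsmul, ← natCast_zsmul, smul_smul, smul_smul, ← add_smul, huv, one_smul]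
  rw [this, hm, smul_zero, add_zero]
  exact H.zsmul_mem hc u

lemma half_mem_of_forall {H : AddSubgroup (Half M)} {m : ℕ} (hm : Odd m)
    (h0 : ∀ p : M, m • (p ⊗ₜ[ℤ] (1 : Zhalf)) = 0) (hH : ∀ p : M, p ⊗ₜ[ℤ] (1 : Zhalf) ∈ H)
    (t : Half M) : t ∈ H := by
  induction t using TensorProduct.induction_on with
  | zero => exact H.zero_mem
  | add x y hx hy => exact H.add_mem hx hy
  | tmul p r =>
    obtain ⟨j, k, h⟩ := exists_two_pow_mul_eq_intCast r
    refine mem_of_coprime_nsmul_mem (c := 2 ^ j) (m := m)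
      ((Nat.coprime_two_left.2 hm).pow_left j) ?_ ?_
    · have := congrArg (LinearMap.lTensor M (LinearMap.mulLeft ℤ r)) (h0 p)
      rwa [map_nsmul, map_zero, LinearMap.lTensor_tmul, LinearMap.mulLeft_apply, mul_one] at this
    · have : 2 ^ j • (p ⊗ₜ[ℤ] r) = k • (p ⊗ₜ[ℤ] (1 : Zhalf)) := by
        rw [← TensorProduct.tmul_smul, ← TensorProduct.tmul_smul, nsmul_eq_mul, zsmul_eq_mul,
          mul_one, ← h, mul_comm]
        push_cast
        rfl
      rw [this]
      exact H.zsmul_mem (hH p) k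

end Half

section ScissorsCongruence

variable {F : Type} [Field F]

lemma P_mem_of_pGen_mem {H : AddSubgroup (P F)} (h : ∀ u, pGen F u ∈ H) (p : P F) : p ∈ H := by
  obtain ⟨z, rfl⟩ := QuotientAddGroup.mk_surjective p
  induction z using FreeAbelianGroup.induction_on with
  | zero => exact H.zero_mem
  | of u => exact h u
  | neg u hu => exact H.neg_mem hu
  | add x y hx hy => exact H.add_mem hx hy

lemma pGen_one : pGen F 1 = 0 :=
  (QuotientAddGroup.eq_zero_iff _).2 (AddSubgroup.subset_closure (Or.inl rfl))

lemma pGen_five_term (x y : Fˣ) (hx : (x : F) ≠ 1) (hy : (y : F) ≠ 1) :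
    pGen F x - pGen F y + pGen F (y / x) - pGen F (oneSubInv F x hx / oneSubInv F y hy)
      + pGen F (oneSub F x hx / oneSub F y hy) = 0 :=
  (QuotientAddGroup.eq_zero_iff _).2 (AddSubgroup.subset_closure (Or.inr ⟨x, y, hx, hy, rfl⟩))

lemma exists_P_hom {A : Type*} [AddCommGroup A] (ψ : F → A) (h1 : ψ 1 = 0)
    (h5 : ∀ x y : F, x ≠ 0 → x ≠ 1 → y ≠ 0 → y ≠ 1 →
      ψ x - ψ y + ψ (y / x) - ψ ((1 - x⁻¹) / (1 - y⁻¹)) + ψ ((1 - x) / (1 - y)) = 0) :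
    ∃ φ : P F →+ A, ∀ u : Fˣ, φ (pGen F u) = ψ u := by
  let φ₀ : FreeAbelianGroup Fˣ →+ A := FreeAbelianGroup.lift fun u => ψ u
  have hφ₀ : ∀ u, φ₀ (FreeAbelianGroup.of u) = ψ u := fun u => FreeAbelianGroup.lift_apply_of _ _
  have hker : AddSubgroup.closure (pRelSet F) ≤ φ₀.ker := by
    rw [AddSubgroup.closure_le]
    rintro z (rfl | ⟨x, y, hx, hy, rfl⟩)
    · change φ₀ _ = 0
      rw [hφ₀, Units.val_one, h1]
    · change φ₀ _ = 0
      simp only [map_add, map_sub, hφ₀, Units.val_div_eq_div_val]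
      exact h5 x y x.ne_zero hx y.ne_zero hy
  exact ⟨QuotientAddGroup.lift _ φ₀ hker, fun u => hφ₀ u⟩

open Classical in
/-- The generator `[x] ⊗ 1` of `P(F)[1/2]`, as a function on the whole field. -/
noncomputable def halfGen (x : F) : Half (P F) :=
  if h : x = 0 then 0 else pGen F (Units.mk0 x h) ⊗ₜ[ℤ] (1 : Zhalf)

lemma halfGen_coe (u : Fˣ) : halfGen (u : F) = pGen F u ⊗ₜ[ℤ] (1 : Zhalf) := by
  simp [halfGen]

lemma isFiveTerm_halfGen : IsFiveTerm (halfGen : F → Half (P F)) where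
  map_one := by
    rw [← Units.val_one, halfGen_coe, pGen_one, TensorProduct.zero_tmul]
  five_term x y x0 x1 y0 y1 := by
    have h := pGen_five_term (Units.mk0 x x0) (Units.mk0 y y0) x1 y1
    have h' := congrArg (fun p : P F => p ⊗ₜ[ℤ] (1 : Zhalf)) h
    simp only [TensorProduct.add_tmul, TensorProduct.sub_tmul, TensorProduct.zero_tmul,
      ← halfGen_coe, Units.val_div_eq_div_val] at h'
    exact h'
  eq_zero_of_add_self := half_eq_zero_of_add_self

end ScissorsCongruence

lemma exists_eq_two_pow_mul {n m : ℕ} (hn : n ≠ 0)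
    (hm : Odd m ∧ m ∣ n ∧ ∀ d : ℕ, Odd d → d ∣ n → d ≤ m) : ∃ s, n = 2 ^ s * m := by
  obtain ⟨s, d, hd, h⟩ := Nat.exists_eq_two_pow_mul_odd hn
  have h1 : m ∣ d := by
    refine Nat.Coprime.dvd_of_dvd_mul_left ((Nat.coprime_two_right.2 hm.1).pow_right s) ?_
    rw [← h]
    exact hm.2.1
  have h2 : d ≤ m := hm.2.2 d hd (by rw [h]; exact dvd_mul_left _ _)
  have h3 : d = m := le_antisymm h2 (Nat.le_of_dvd hd.pos h1)
  exact ⟨s, by rw [h, h3]⟩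

end GH

/-- **Statement 13.** For a prime power `q ≥ 4`, `P(𝔽_q) ⊗ ℤ[1/2] ≅ ℤ/m` where `m` is the odd
part of `q + 1`. -/
theorem statement13 (q m : ℕ) (F : Type) [Field F] [Fintype F]
    (hcard : Fintype.card F = q) (hq : 4 ≤ q)
    (hm : Odd m ∧ m ∣ q + 1 ∧ ∀ d : ℕ, Odd d → d ∣ q + 1 → d ≤ m) :
    Nonempty ((GH.Half (GH.P F)) ≃+ ZMod m) := by
  open GH in
  subst hcard
  obtain ⟨s, hs⟩ := exists_eq_two_pow_mul (Nat.succ_ne_zero _) hm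
  obtain ⟨hodd, hdvd, -⟩ := hm
  have : NeZero m := ⟨hodd.pos.ne'⟩
  classical
  obtain ⟨K, _, _, _, hK⟩ := exists_quadratic_extension F
  obtain ⟨S, hS⟩ := exists_unitCircle hK
  obtain ⟨θ, hθ⟩ := exists_bar_ne hK hS
  have hb := isFiveTerm_halfGen (F := F)
  obtain ⟨a, ha⟩ := UnitCircle.exists_two_nsmul_mem_zmultiples hS hb hq hK rfl hθ
  have hkill : ∀ u : Fˣ, m • halfGen (u : F) = 0 := fun u => by
    refine half_eq_zero_of_two_pow_nsmul s _ ?_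
    rw [smul_smul, ← hs]
    exact hb.card_add_one_smul hq u.ne_zero
  let ι : P F →+ Half (P F) := ((TensorProduct.mk ℤ (P F) Zhalf).flip 1).toAddMonoidHom
  have hkill' : ∀ p : P F, m • (p ⊗ₜ[ℤ] (1 : Zhalf)) = 0 := fun p => by
    refine P_mem_of_pGen_mem (H := ((nsmulAddMonoidHom m).comp ι).ker) (fun u => ?_) p
    exact (congrArg (m • ·) (halfGen_coe u).symm).trans (hkill u)
  have hmem : ∀ p : P F, p ⊗ₜ[ℤ] (1 : Zhalf) ∈ AddSubgroup.zmultiples a := fun p => by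
    refine P_mem_of_pGen_mem (H := (AddSubgroup.zmultiples a).comap ι) (fun u => ?_) p
    change pGen F u ⊗ₜ[ℤ] (1 : Zhalf) ∈ AddSubgroup.zmultiples a
    rw [← halfGen_coe]
    exact mem_of_coprime_nsmul_mem (Nat.coprime_two_left.2 hodd) (hkill u) (ha u u.ne_zero)
  have hgen : ∀ t : Half (P F), t ∈ AddSubgroup.zmultiples a :=
    half_mem_of_forall hodd hkill' hmem
  have ha0 : m • a = 0 :=
    half_mem_of_forall (H := (nsmulAddMonoidHom (α := Half (P F)) m).ker) hodd hkill' hkill' a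
  let f : ZMod m →+ Half (P F) := ZMod.lift m ⟨zmultiplesHom _ a, by simpa using ha0⟩
  have hf : Function.Surjective f := fun t => by
    obtain ⟨k, rfl⟩ := hgen t
    exact ⟨k, ZMod.lift_coe _ _ _⟩
  obtain ⟨ψ, h1, h5, hψ⟩ := UnitCircle.exists_five_term_zmod hK hq hS hθ hodd hdvd
  obtain ⟨φ, hφ⟩ := exists_P_hom ψ h1 h5
  obtain ⟨ρ⟩ := exists_zhalf_ringHom hodd
  let g : Half (P F) →+ ZMod m := ((LinearMap.mul' ℤ (ZMod m)).comp
    (TensorProduct.map φ.toIntLinearMap ρ.toAddMonoidHom.toIntLinearMap)).toAddMonoidHom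
  have hg : Function.Surjective g := by
    rw [← AddMonoidHom.range_eq_top]
    refine hψ _ fun x x0 => ⟨pGen F (Units.mk0 x x0) ⊗ₜ[ℤ] 1, ?_⟩
    change φ _ * ρ 1 = _
    rw [map_one, mul_one, hφ, Units.val_mk0]
  have hgf : Function.Injective (g ∘ f) := Finite.injective_iff_surjective.2 (hg.comp hf)
  exact ⟨(AddEquiv.ofBijective f ⟨hgf.of_comp, hf⟩).symm⟩
end
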